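/- arXiv:2503.19387 — 3 statements merged into one kernel-verified Lean document; each statement's English description precedes it below -/
import Mathlib

section
/- Every irredundant generating set for M_n(F) has at most 2n−1 elements. -/
section Socle

variable (R M : Type*) [Ring R] [AddCommGroup M] [Module R M]

/-- The socle of a module: the sum of its simple submodules. -/
def moduleSocle : Submodule R M := sSup {m | IsSimpleModule R m}

/-- The length of a module plus the length of its socle. -/
noncomputable def socleWeight : ℕ∞ := Module.length R M + Module.length R (moduleSocle R M)

variable {R M}

theorem le_moduleSocle (N : Submodule R M) [h : IsSimpleModule R N] : N ≤ moduleSocle R M :=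
  le_sSup h

theorem moduleSocle_eq_top_iff : moduleSocle R M = ⊤ ↔ IsSemisimpleModule R M :=
  sSup_simples_eq_top_iff_isSemisimpleModule

instance : IsSemisimpleModule R (moduleSocle R M) := by
  have h := isSemisimpleModule_biSup_of_isSemisimpleModule_submodule
    (s := {m : Submodule R M | IsSimpleModule R m}) (p := id)
    (fun m (hm : IsSimpleModule R m) ↦ (inferInstance : IsSemisimpleModule R m))
  rw [moduleSocle, sSup_eq_iSup]
  exact h

theorem exists_isSimpleModule_le [IsArtinian R M] {N : Submodule R M} (hN : N ≠ ⊥) :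
    ∃ X ≤ N, IsSimpleModule R X := by
  obtain ⟨X, hX, hXN⟩ := (eq_bot_or_exists_atom_le N).resolve_left hN
  exact ⟨X, hXN, isSimpleModule_iff_isAtom.2 hX⟩

theorem moduleSocle_ne_bot [IsArtinian R M] [Nontrivial M] : moduleSocle R M ≠ ⊥ := by
  obtain ⟨X, -, hX⟩ := exists_isSimpleModule_le (R := R) (M := M) top_ne_bot
  exact fun h ↦ (isSimpleModule_iff_isAtom.1 hX).1 (eq_bot_iff.2 (h ▸ le_moduleSocle X))

theorem length_moduleSocle_le : Module.length R (moduleSocle R M) ≤ Module.length R M :=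
  Module.length_le_of_injective _ (Submodule.subtype_injective _)

theorem length_moduleSocle [IsSemisimpleModule R M] :
    Module.length R (moduleSocle R M) = Module.length R M := by
  rw [moduleSocle_eq_top_iff.2 ‹_›, Module.length_top]

theorem socleWeight_of_isSimpleModule [IsSimpleModule R M] : socleWeight R M = 2 := by
  rw [socleWeight, length_moduleSocle, Module.length_eq_one]
  rfl

theorem Submodule.eq_of_le_of_length_le [IsArtinian R M] [IsNoetherian R M]
    {N P : Submodule R M} (h : N ≤ P) (hl : Module.length R P ≤ Module.length R N) : N = P := by
  by_contra hne
  have := Submodule.height_strictMono (lt_of_le_of_ne h hne)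
  rw [← Module.length_submodule, ← Module.length_submodule] at this
  exact this.not_ge hl

end Socle

section RestrictScalars

variable {A B V : Type*} [Ring A] [Ring B] [AddCommGroup V] [Module A V] [Module B V] [SMul A B]
  [IsScalarTower A B V]

variable (A B V) in
theorem length_le_length_of_isScalarTower : Module.length B V ≤ Module.length A V := by
  rw [← WithBot.coe_le_coe, Module.coe_length, Module.coe_length]
  exact Order.krullDim_le_of_orderEmbedding (Submodule.restrictScalarsEmbedding A B V)

variable [IsArtinian A V]

variable (A B V) in
theorem length_moduleSocle_le_of_isScalarTower :
    Module.length B (moduleSocle B V) ≤ Module.length A (moduleSocle A V) := by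
  rw [← WithBot.coe_le_coe, Module.coe_length, Module.coe_length]
  let f (N : Submodule B (moduleSocle B V)) : Submodule A (moduleSocle A V) :=
    ((N.map (Submodule.subtype _)).restrictScalars A).comap (Submodule.subtype _)
  refine Order.krullDim_le_of_strictMono f fun N P h ↦ ?_
  refine lt_of_le_of_ne ?_ fun heq ↦ ?_
  · exact Submodule.comap_mono (Submodule.restrictScalars_mono A (Submodule.map_mono h.le))
  · obtain ⟨X, hX, hXP, hXN⟩ : ∃ X : Submodule B (moduleSocle B V),
        IsSimpleModule B X ∧ X ≤ P ∧ ¬ X ≤ N := by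
      by_contra! hc
      refine h.not_ge ?_
      rw [← IsSemisimpleModule.sSup_simples_le P]
      exact sSup_le fun X hX ↦ hc X hX.1 hX.2
    have hX' := isSimpleModule_iff_isAtom.1 hX
    obtain ⟨Y, hY, hYs⟩ := exists_isSimpleModule_le
      (N := (X.map (Submodule.subtype _)).restrictScalars A) (by
        rw [Ne, Submodule.restrictScalars_eq_bot_iff]
        refine ((Submodule.map_injective_of_injective
          (Submodule.subtype_injective _)).ne_iff' (Submodule.map_bot _)).2 ?_
        exact hX'.1)
    obtain ⟨y, hy, hy0⟩ :=
      Submodule.exists_mem_ne_zero_of_ne_bot (isSimpleModule_iff_isAtom.1 hYs).1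
    obtain ⟨x, hx, rfl⟩ := hY hy
    have h1 : (⟨x, le_moduleSocle Y hy⟩ : moduleSocle A V) ∈ f P := ⟨x, hXP hx, rfl⟩
    rw [← heq] at h1
    obtain ⟨x', hx', hxx⟩ := h1
    have : x' = x := Subtype.ext hxx
    subst this
    have : X ⊓ N = ⊥ := (hX'.not_le_iff_disjoint.1 hXN).eq_bot
    have h2 : x' ∈ X ⊓ N := ⟨hx, hx'⟩
    rw [this, Submodule.mem_bot] at h2
    exact hy0 (by simp [h2])

variable [IsNoetherian A V] (hl : Module.length A V = Module.length B V)

include hl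

theorem length_restrictScalars_eq (N : Submodule B V) :
    Module.length A (N.restrictScalars A) = Module.length B N := by
  have hA : Module.length A V = _ := Module.length_eq_add_of_exact
    (N.restrictScalars A).subtype (N.restrictScalars A).mkQ
    (Submodule.subtype_injective _) (Submodule.mkQ_surjective _)
    (LinearMap.exact_subtype_mkQ _)
  have hB : Module.length B V = _ := Module.length_eq_add_of_exact
    N.subtype N.mkQ (Submodule.subtype_injective _) (Submodule.mkQ_surjective _)
    (LinearMap.exact_subtype_mkQ _)
  have h1 := Submodule.length_le_length_restrictScalars A N
  have h2 : Module.length B (V ⧸ N) ≤ Module.length A (V ⧸ N.restrictScalars A) :=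
    length_le_length_of_isScalarTower A B (V ⧸ N)
  have hfin : Module.length A V ≠ ⊤ := Module.length_ne_top
  refine le_antisymm ?_ h1
  rw [hl, hB] at hA
  rw [hl, hB] at hfin
  have h3 : Module.length B (V ⧸ N) ≠ ⊤ := fun h ↦ hfin (by rw [h, add_top])
  by_contra! hlt
  exact hA.not_lt (ENat.add_lt_add_of_lt_of_le h3 hlt h2)

theorem isSimpleModule_restrictScalars (N : Submodule B V) [IsSimpleModule B N] :
    IsSimpleModule A (N.restrictScalars A) := by
  rw [← Module.length_eq_one_iff, length_restrictScalars_eq hl, Module.length_eq_one]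

theorem restrictScalars_moduleSocle
    (hs : Module.length A (moduleSocle A V) = Module.length B (moduleSocle B V)) :
    (moduleSocle B V).restrictScalars A = moduleSocle A V := by
  refine Submodule.eq_of_le_of_length_le ?_ (by rw [length_restrictScalars_eq hl, hs])
  rw [moduleSocle, Submodule.restrictScalars_sSup]
  refine sSup_le ?_
  rintro _ ⟨X, hX, rfl⟩
  have : IsSimpleModule B X := hX
  have := isSimpleModule_restrictScalars hl X
  exact le_moduleSocle _

theorem Submodule.IsFullyInvariant.exists_restrictScalars_eq [IsSemisimpleModule A V]
    [IsSemisimpleModule B V] {N : Submodule A V} (hN : N.IsFullyInvariant) :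
    ∃ P : Submodule B V, P.restrictScalars A = N := by
  let s : Set (Submodule B V) := {X | IsSimpleModule B X ∧ X.restrictScalars A ≤ N}
  let t : Set (Submodule B V) := {X | IsSimpleModule B X ∧ ¬ X.restrictScalars A ≤ N}
  have htop : sSup s ⊔ sSup t = ⊤ := by
    rw [← sSup_union, ← IsSemisimpleModule.sSup_simples_eq_top B V]
    congr 1
    ext X
    simp only [s, t, Set.mem_union, Set.mem_ofPred_eq]
    tauto
  have hs : (sSup s).restrictScalars A ≤ N := by
    rw [Submodule.restrictScalars_sSup]
    refine sSup_le ?_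
    rintro _ ⟨X, hX, rfl⟩
    exact hX.2
  have ht : (sSup t).restrictScalars A ⊓ N = ⊥ := by
    by_contra hne
    obtain ⟨Y, hY, hYs⟩ := exists_isSimpleModule_le hne
    have hYt := hY.trans inf_le_left
    rw [Submodule.restrictScalars_sSup] at hYt
    have (m : (Submodule.restrictScalars A) '' t) : IsSimpleModule A m.1 := by
      obtain ⟨_, X, hX, rfl⟩ := m
      have : IsSimpleModule B X := hX.1
      exact isSimpleModule_restrictScalars hl X
    obtain ⟨_, ⟨X, hX, rfl⟩, ⟨e⟩⟩ := Y.linearEquiv_of_le_sSup _ hYt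
    refine hX.2 (le_trans ?_
      (isFullyInvariant_iff_le_imp_isotypicComponent_le.1 hN Y (hY.trans inf_le_right)))
    exact le_sSup ⟨e.symm⟩
  refine ⟨sSup s, le_antisymm hs ?_⟩
  have htop' : (sSup s).restrictScalars A ⊔ (sSup t).restrictScalars A = ⊤ := by
    rw [← Submodule.restrictScalars_sup, htop, Submodule.restrictScalars_top]
  calc N = ((sSup s).restrictScalars A ⊔ (sSup t).restrictScalars A) ⊓ N := by
        rw [htop', top_inf_eq]
    _ = (sSup s).restrictScalars A ⊔ ((sSup t).restrictScalars A ⊓ N) :=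
      sup_inf_assoc_of_le _ hs
    _ = (sSup s).restrictScalars A := by rw [ht, sup_bot_eq]
    _ ≤ _ := le_rfl

end RestrictScalars

section Isotypic

variable {A B V : Type*} [Ring A] [Ring B] [AddCommGroup V] [Module A V] [Module B V] [SMul A B]
  [IsScalarTower A B V] [IsArtinian A V]

theorem exists_restrictScalars_eq_of_isIsotypic [IsNoetherian A V] (K : Type*) [Field K]
    [IsAlgClosed K] [Module K V] [FiniteDimensional K V] [Algebra K A] [IsScalarTower K A V]
    [SMulCommClass B K V] [IsNoetherian B V] [IsSemisimpleModule B V] (hiso : IsIsotypic B V)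
    (hl : Module.length A V = Module.length B V) (Y : Submodule A V) [IsSimpleModule A Y] :
    ∃ P : Submodule B V, P.restrictScalars A = Y := by
  have := IsSimpleModule.nontrivial A Y
  have : Nontrivial V := Y.injective_subtype.nontrivial
  obtain ⟨m, -, X, hX, ⟨e⟩⟩ := hiso.linearEquiv_fun
  have hXA := isSimpleModule_restrictScalars hl X
  let g (i : Fin m) : Y →ₗ[A] X.restrictScalars A :=
    { toFun y := e y i
      map_add' y z := by simp; rfl
      map_smul' a y := by
        ext
        have : ((a • y : Y) : V) = (a • (1 : B)) • (y : V) := by simp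
        rw [this, map_smul]
        simp
        rfl }
  obtain ⟨j, hj⟩ : ∃ j, g j ≠ 0 := by
    by_contra! h0
    obtain ⟨y, hy⟩ := exists_ne (0 : Y)
    refine hy (Subtype.ext (e.injective ?_))
    rw [Submodule.coe_zero, map_zero]
    exact funext fun i ↦ congr($(h0 i) y)
  have : FiniteDimensional K (X.restrictScalars A) :=
    .of_injective ((X.restrictScalars A).subtype.restrictScalars K) (Submodule.subtype_injective _)
  let h := LinearEquiv.ofBijective (g j) (LinearMap.bijective_of_ne_zero hj)
  have hscal (i : Fin m) : ∃ c : K, ∀ y : Y, g i y = c • g j y := by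
    obtain ⟨c, hc⟩ := (IsSimpleModule.algebraMap_end_bijective_of_isAlgClosed K).2
      (g i ∘ₗ h.symm.toLinearMap)
    refine ⟨c, fun y ↦ ?_⟩
    have := congr($hc (h y))
    simpa [h] using this.symm
  choose c hc using hscal
  refine ⟨{ Y with smul_mem' := fun b v hv ↦ ?_ }, rfl⟩
  let y := h.symm (b • (g j ⟨v, hv⟩ : X))
  have hy : g j y = (b • (g j ⟨v, hv⟩ : X) : X) := h.apply_symm_apply _
  have : b • v = y := by
    refine e.injective (funext fun i ↦ Subtype.ext ?_)
    have h1 : (e y i : V) = c i • (g j y : V) := congr(($(hc i y) : V))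
    have h2 : (e v i : V) = c i • (g j ⟨v, hv⟩ : V) := congr(($(hc i ⟨v, hv⟩) : V))
    rw [h1, hy, map_smul, Pi.smul_apply, Submodule.coe_smul, h2, smul_comm]
    rfl
  rw [this]
  exact y.2

theorem socleWeight_eq_or_add_two_le [IsNoetherian B V] [IsSemisimpleModule B V]
    (hiso : IsIsotypic B V) (h2 : 2 ≤ Module.length B V) :
    socleWeight A V = socleWeight B V ∨ socleWeight B V + 2 ≤ socleWeight A V := by
  have : Nontrivial V := by
    rw [← Module.length_pos_iff (R := B)]
    exact lt_of_lt_of_le two_pos h2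
  obtain ⟨m, -, X, hX, ⟨e⟩⟩ := hiso.linearEquiv_fun
  have hB : Module.length B V = m := by simp [e.length_eq]
  let e' : V ≃ₗ[A] Fin m → X.restrictScalars A :=
    { e with
      map_smul' a v := by
        ext i
        have : a • v = (a • (1 : B)) • v := by simp
        simp only [this]
        simp
        rfl }
  have hA : Module.length A V = m * Module.length A (X.restrictScalars A) := by
    simp [e'.length_eq]
  have hs := length_moduleSocle_le_of_isScalarTower A B V
  have : Nontrivial (X.restrictScalars A) := IsSimpleModule.nontrivial B X
  have h1 : 1 ≤ Module.length A (X.restrictScalars A) :=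
    Order.one_le_iff_pos.2 Module.length_pos
  rcases h1.eq_or_lt' with h1 | h1
  · left
    have : IsSimpleModule A (X.restrictScalars A) := Module.length_eq_one_iff.1 h1
    have : IsSemisimpleModule A V := .congr e'
    rw [socleWeight, socleWeight, length_moduleSocle, length_moduleSocle, hA, hB, h1, mul_one]
  · right
    rw [socleWeight, socleWeight, add_right_comm]
    refine add_le_add ?_ hs
    calc Module.length B V + 2 ≤ m + m := by rw [hB] at h2 ⊢; gcongr
      _ = m * 2 := (mul_two _).symm
      _ ≤ _ := by rw [hA]; gcongr; exact Order.add_one_le_of_lt h1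

end Isotypic

section Weight

variable {A B V : Type*} [Ring A] [Ring B] [AddCommGroup V] [Module A V] [Module B V] [SMul A B]
  [IsScalarTower A B V] [IsArtinian A V]

variable (A B V) in
theorem socleWeight_le_of_isScalarTower : socleWeight B V ≤ socleWeight A V :=
  add_le_add (length_le_length_of_isScalarTower A B V)
    (length_moduleSocle_le_of_isScalarTower A B V)

variable [IsNoetherian A V]

theorem length_eq_and_of_socleWeight_le (h : socleWeight A V ≤ socleWeight B V) :
    Module.length A V = Module.length B V ∧
      Module.length A (moduleSocle A V) = Module.length B (moduleSocle B V) := by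
  have h1 := length_le_length_of_isScalarTower A B V
  have h2 := length_moduleSocle_le_of_isScalarTower A B V
  have h3 : Module.length A V ≠ ⊤ := Module.length_ne_top
  have h4 : Module.length A (moduleSocle A V) ≠ ⊤ := Module.length_ne_top
  rw [socleWeight, socleWeight] at h
  generalize Module.length A V = a at *
  generalize Module.length A (moduleSocle A V) = a' at *
  generalize Module.length B V = b at *
  generalize Module.length B (moduleSocle B V) = b' at *
  lift a to ℕ using h3
  lift a' to ℕ using h4
  lift b to ℕ using ne_top_of_le_ne_top (ENat.natCast_ne_top _) h1
  lift b' to ℕ using ne_top_of_le_ne_top (ENat.natCast_ne_top _) h2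
  norm_cast at *
  omega

theorem exists_ne_bot_ne_top_restrictScalars [Nontrivial V]
    (hA : ¬ (IsSemisimpleModule A V ∧ IsIsotypic A V)) :
    ∃ N : Submodule A V, N ≠ ⊥ ∧ N ≠ ⊤ ∧
      ∀ (B : Type*) [Ring B] [Module B V] [SMul A B] [IsScalarTower A B V],
        socleWeight A V ≤ socleWeight B V → ∃ P : Submodule B V, P.restrictScalars A = N := by
  by_cases hss : IsSemisimpleModule A V
  · have hiso : ¬ IsIsotypic A V := fun h ↦ hA ⟨hss, h⟩
    rw [isIsotypic_iff_isFullyInvariant_imp_bot_or_top] at hiso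
    push Not at hiso
    obtain ⟨N, hN, hbot, htop⟩ := hiso
    refine ⟨N, hbot, htop, fun B _ _ _ _ hw ↦ ?_⟩
    obtain ⟨hl, hs⟩ := length_eq_and_of_socleWeight_le hw
    have := restrictScalars_moduleSocle hl hs
    rw [moduleSocle_eq_top_iff.2 hss, Submodule.restrictScalars_eq_top_iff,
      moduleSocle_eq_top_iff] at this
    exact hN.exists_restrictScalars_eq hl
  · refine ⟨moduleSocle A V, moduleSocle_ne_bot, mt moduleSocle_eq_top_iff.1 hss,
      fun B _ _ _ _ hw ↦ ⟨moduleSocle B V, ?_⟩⟩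
    obtain ⟨hl, hs⟩ := length_eq_and_of_socleWeight_le hw
    exact restrictScalars_moduleSocle hl hs

end Weight

section Subalgebra

variable {K V : Type*} [Field K] [AddCommGroup V] [Module K V]

/-- The left multiplication action of a subalgebra on a larger one. -/
abbrev Subalgebra.smulOfLE {R : Type*} [Ring R] [Algebra K R] {A B : Subalgebra K R} (h : A ≤ B) :
    SMul A B :=
  ⟨fun a b ↦ Subalgebra.inclusion h a * b⟩

theorem Subalgebra.isScalarTower_of_le {A B : Subalgebra K (Module.End K V)} (h : A ≤ B) :
    let := Subalgebra.smulOfLE h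
    IsScalarTower A B V :=
  letI := Subalgebra.smulOfLE h
  ⟨fun _ _ _ ↦ rfl⟩

theorem Module.End.eq_bot_or_eq_top_of_adjoin_eq_top {S : Set (Module.End K V)}
    (hS : Algebra.adjoin K S = ⊤) (N : Submodule K V) (hN : ∀ a ∈ S, ∀ x ∈ N, a x ∈ N) :
    N = ⊥ ∨ N = ⊤ := by
  have hall (f : Module.End K V) : ∀ x ∈ N, f x ∈ N := by
    have hf : f ∈ Algebra.adjoin K S := hS ▸ Algebra.mem_top
    induction hf using Algebra.adjoin_induction with
    | mem a ha => exact hN a ha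
    | algebraMap c => exact fun x hx ↦ N.smul_mem c hx
    | add f g _ _ hf hg => exact fun x hx ↦ N.add_mem (hf x hx) (hg x hx)
    | mul f g _ _ hf hg => exact fun x hx ↦ hf _ (hg x hx)
  cases subsingleton_or_nontrivial V
  · exact .inl (Subsingleton.elim _ _)
  let N' : Submodule (Module.End K V) V := { N with smul_mem' := fun f x hx ↦ hall f x hx }
  have hN' : N'.restrictScalars K = N := rfl
  rw [← hN', Submodule.restrictScalars_eq_bot_iff, Submodule.restrictScalars_eq_top_iff]
  exact eq_bot_or_eq_top N'

variable {S : Set (Module.End K V)}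

theorem exists_finset_insert_sup_adjoin_eq_top {A : Subalgebra K (Module.End K V)}
    {a : Module.End K V} (ha : a ∈ S) {T : Finset (Module.End K V)} (hT : ↑T ⊆ S)
    (h : (A ⊔ Algebra.adjoin K {a}) ⊔ Algebra.adjoin K T = ⊤) :
    ∃ T' : Finset (Module.End K V), ↑T' ⊆ S ∧ A ⊔ Algebra.adjoin K T' = ⊤ ∧
      T'.card ≤ T.card + 1 := by
  classical
  refine ⟨insert a T, ?_, ?_, Finset.card_insert_le _ _⟩
  · rw [Finset.coe_insert]
    exact Set.insert_subset ha hT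
  · rw [Finset.coe_insert, Set.insert_eq, Algebra.adjoin_union, ← sup_assoc, h]

theorem exists_notMem_of_adjoin_eq_top (hS : Algebra.adjoin K S = ⊤)
    (A : Subalgebra K (Module.End K V)) {N : Submodule A V} (hbot : N ≠ ⊥) (htop : N ≠ ⊤) :
    ∃ a ∈ S, ∀ B : Subalgebra K (Module.End K V), A ≤ B → a ∈ B →
      ∀ P : Submodule B V, (P : Set V) ≠ N := by
  by_contra! hc
  refine (Module.End.eq_bot_or_eq_top_of_adjoin_eq_top hS (N.restrictScalars K)
    fun a ha x hx ↦ ?_).elim (by simpa using hbot) (by simpa using htop)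
  obtain ⟨B, -, haB, P, hP⟩ := hc a ha
  have : x ∈ P := by rw [← SetLike.mem_coe, hP]; exact hx
  have := P.smul_mem (⟨a, haB⟩ : B) this
  rw [← SetLike.mem_coe, hP] at this
  exact this

variable [FiniteDimensional K V]

instance (A : Subalgebra K (Module.End K V)) : IsNoetherian A V :=
  isNoetherian_of_tower K inferInstance

instance (A : Subalgebra K (Module.End K V)) : IsArtinian A V :=
  isArtinian_of_tower K inferInstance

theorem Subalgebra.eq_top_of_isSimpleModule [IsAlgClosed K] (A : Subalgebra K (Module.End K V))
    [IsSimpleModule A V] : A = ⊤ := by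
  have hsc := (IsSimpleModule.algebraMap_end_bijective_of_isAlgClosed (A := A) (V := V) K).2
  have : IsScalarTower K (Module.End A V) V := ⟨fun _ _ _ ↦ rfl⟩
  have : Module.Finite (Module.End A V) V := .of_restrictScalars_finite K _ _
  rw [Algebra.eq_top_iff]
  intro f
  let f' : Module.End (Module.End A V) V :=
    { f with
      map_smul' g v := by
        obtain ⟨c, rfl⟩ := hsc g
        exact f.map_smul c v }
  obtain ⟨a, ha⟩ := Module.Finite.toModuleEnd_moduleEnd_surjective (R := A) (M := V) f'
  have : f = a := LinearMap.ext fun v ↦ congr($ha v).symm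
  rw [this]
  exact a.2

variable [Nontrivial V]

theorem exists_socleWeight_lt (hS : Algebra.adjoin K S = ⊤)
    (A : Subalgebra K (Module.End K V)) (hA : ¬ (IsSemisimpleModule A V ∧ IsIsotypic A V)) :
    ∃ a ∈ S, ∀ B : Subalgebra K (Module.End K V), A ≤ B → a ∈ B →
      socleWeight B V < socleWeight A V := by
  obtain ⟨N, hbot, htop, hN⟩ := exists_ne_bot_ne_top_restrictScalars hA
  obtain ⟨a, ha, h⟩ := exists_notMem_of_adjoin_eq_top hS A hbot htop
  refine ⟨a, ha, fun B hAB haB ↦ ?_⟩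
  let := Subalgebra.smulOfLE hAB
  have := Subalgebra.isScalarTower_of_le hAB
  by_contra! hw
  obtain ⟨P, rfl⟩ := hN B hw
  exact h B hAB haB P rfl

variable [IsAlgClosed K]

theorem exists_socleWeight_lt_of_isIsotypic (hS : Algebra.adjoin K S = ⊤)
    (A : Subalgebra K (Module.End K V)) (hA : ¬ IsSimpleModule A V) :
    ∃ a ∈ S, ∀ B : Subalgebra K (Module.End K V), A ≤ B → a ∈ B →
      IsSemisimpleModule B V → IsIsotypic B V → socleWeight B V < socleWeight A V := by
  obtain ⟨Y, -, hY⟩ := exists_isSimpleModule_le (R := A) (M := V) top_ne_bot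
  have hbot := (isSimpleModule_iff_isAtom.1 hY).1
  have htop : Y ≠ ⊤ := by
    rintro rfl
    have := Module.length_eq_one A (⊤ : Submodule A V)
    exact hA (Module.length_eq_one_iff.1 (Module.length_top.symm.trans this))
  obtain ⟨a, ha, h⟩ := exists_notMem_of_adjoin_eq_top hS A hbot htop
  refine ⟨a, ha, fun B hAB haB _ hiso ↦ ?_⟩
  let := Subalgebra.smulOfLE hAB
  have := Subalgebra.isScalarTower_of_le hAB
  by_contra! hw
  obtain ⟨P, rfl⟩ :=
    exists_restrictScalars_eq_of_isIsotypic K hiso (length_eq_and_of_socleWeight_le hw).1 Y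
  exact h B hAB haB P rfl

theorem exists_finset_sup_adjoin_eq_top (hS : Algebra.adjoin K S = ⊤) (w : ℕ)
    (A : Subalgebra K (Module.End K V)) (hw : socleWeight A V = w) :
    ∃ T : Finset (Module.End K V), ↑T ⊆ S ∧ A ⊔ Algebra.adjoin K T = ⊤ ∧ T.card + 1 ≤ w ∧
      (IsSimpleModule A V → T.card = 0) ∧
      (¬ (IsSemisimpleModule A V ∧ IsIsotypic A V) → T.card + 2 ≤ w) := by
  induction w using Nat.strong_induction_on generalizing A with
  | _ w ih =>
  have hle (A : Subalgebra K (Module.End K V)) (a : Module.End K V) :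
      A ≤ A ⊔ Algebra.adjoin K {a} := le_sup_left
  have hmem (A : Subalgebra K (Module.End K V)) (a : Module.End K V) :
      a ∈ A ⊔ Algebra.adjoin K {a} :=
    (le_sup_right : _ ≤ A ⊔ Algebra.adjoin K {a}) (Algebra.self_mem_adjoin_singleton K a)
  have hgen (A : Subalgebra K (Module.End K V)) (hw : socleWeight A V = w)
      (hA : ¬ (IsSemisimpleModule A V ∧ IsIsotypic A V)) :
      ∃ T : Finset (Module.End K V), ↑T ⊆ S ∧ A ⊔ Algebra.adjoin K T = ⊤ ∧ T.card + 2 ≤ w := by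
    obtain ⟨a, ha, hlt⟩ := exists_socleWeight_lt hS A hA
    specialize hlt _ (hle A a) (hmem A a)
    obtain ⟨B, hB⟩ : ∃ B, B = A ⊔ Algebra.adjoin K {a} := ⟨_, rfl⟩
    have hAB : A ≤ B := hB ▸ hle A a
    rw [← hB] at hlt
    let := Subalgebra.smulOfLE hAB
    have := Subalgebra.isScalarTower_of_le hAB
    obtain ⟨v, hv⟩ := ENat.ne_top_iff_exists.1 hlt.ne_top
    rw [← hv, hw, Nat.cast_lt] at hlt
    obtain ⟨T, hT, hTtop, hTv, hTs, hTg⟩ := ih v hlt B hv.symm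
    obtain ⟨T', hT', hTtop', hcard⟩ := exists_finset_insert_sup_adjoin_eq_top ha hT (hB ▸ hTtop)
    refine ⟨T', hT', hTtop', ?_⟩
    by_cases hBg : IsSemisimpleModule B V ∧ IsIsotypic B V
    · by_cases hBs : IsSimpleModule B V
      · have := hTs hBs
        rw [socleWeight_of_isSimpleModule] at hv
        norm_cast at hv
        omega
      · have := hBg.1
        have h2 : 2 ≤ Module.length B V := by
          have h1 : 1 ≤ Module.length B V := Order.one_le_iff_pos.2 Module.length_pos
          rw [← one_add_one_eq_two]
          exact Order.add_one_le_of_lt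
            (lt_of_le_of_ne h1 fun h ↦ hBs (Module.length_eq_one_iff.1 h.symm))
        have := socleWeight_eq_or_add_two_le (A := A) hBg.2 h2
        rw [← hv, hw] at this
        norm_cast at this
        omega
    · have := hTg hBg
      omega
  by_cases hA : IsSemisimpleModule A V ∧ IsIsotypic A V
  · by_cases hAs : IsSimpleModule A V
    · refine ⟨∅, by simp, by simp [A.eq_top_of_isSimpleModule], ?_, by simp, fun h ↦ (h hA).elim⟩
      rw [socleWeight_of_isSimpleModule] at hw
      norm_cast at hw
      simp [← hw]
    · suffices ∃ T : Finset (Module.End K V), ↑T ⊆ S ∧ A ⊔ Algebra.adjoin K T = ⊤ ∧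
          T.card + 1 ≤ w by
        obtain ⟨T, hT, hTtop, hcard⟩ := this
        exact ⟨T, hT, hTtop, hcard, fun h ↦ (hAs h).elim, fun h ↦ (h hA).elim⟩
      obtain ⟨a, ha, hlt⟩ := exists_socleWeight_lt_of_isIsotypic hS A hAs
      specialize hlt _ (hle A a) (hmem A a)
      have hsm := Subalgebra.isScalarTower_of_le (hle A a)
      let := Subalgebra.smulOfLE (hle A a)
      have hBA := socleWeight_le_of_isScalarTower A ↥(A ⊔ Algebra.adjoin K {a}) V
      obtain hBA | hBA := hBA.lt_or_eq
      · obtain ⟨v, hv⟩ := ENat.ne_top_iff_exists.1 hBA.ne_top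
        rw [← hv, hw, Nat.cast_lt] at hBA
        obtain ⟨T, hT, hTtop, hTv, -⟩ := ih v hBA _ hv.symm
        obtain ⟨T', hT', hTtop', hcard⟩ := exists_finset_insert_sup_adjoin_eq_top ha hT hTtop
        exact ⟨T', hT', hTtop', by omega⟩
      · obtain ⟨T, hT, hTtop, hTv⟩ := hgen _ (hBA.trans hw) fun h ↦ (hlt h.1 h.2).ne hBA
        obtain ⟨T', hT', hTtop', hcard⟩ := exists_finset_insert_sup_adjoin_eq_top ha hT hTtop
        exact ⟨T', hT', hTtop', by omega⟩
  · obtain ⟨T, hT, hTtop, hcard⟩ := hgen A hw hA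
    refine ⟨T, hT, hTtop, by omega, fun h ↦ (hA ⟨inferInstance, ?_⟩).elim, fun _ ↦ hcard⟩
    exact (IsIsotypicOfType.of_isSimpleModule A V).isIsotypic

theorem exists_finset_card_lt_adjoin_eq_top (hS : Algebra.adjoin K S = ⊤) :
    ∃ T : Finset (Module.End K V), ↑T ⊆ S ∧ Algebra.adjoin K (T : Set (Module.End K V)) = ⊤ ∧
      T.card + 1 ≤ 2 * Module.finrank K V := by
  have h : socleWeight (⊥ : Subalgebra K (Module.End K V)) V ≤ (2 * Module.finrank K V : ℕ) := by
    have := length_le_length_of_isScalarTower K (⊥ : Subalgebra K (Module.End K V)) V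
    rw [Module.length_eq_finrank] at this
    calc _ ≤ (Module.finrank K V : ℕ∞) + Module.finrank K V :=
          add_le_add this (length_moduleSocle_le.trans this)
      _ = _ := by push_cast; rw [two_mul]
  obtain ⟨w, hw⟩ := ENat.ne_top_iff_exists.1 (ne_top_of_le_ne_top (ENat.natCast_ne_top _) h)
  obtain ⟨T, hT, htop, hcard, -⟩ := exists_finset_sup_adjoin_eq_top hS w ⊥ hw.symm
  rw [← hw, Nat.cast_le] at h
  rw [bot_sup_eq] at htop
  exact ⟨T, hT, htop, hcard.trans h⟩

end Subalgebra

section BaseChange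

variable {F K : Type*} [Field F] [Field K] [Algebra F K] {n : Type*} [Fintype n] [DecidableEq n]

variable (F K n) in
/-- Extension of scalars for matrices, viewed as acting on column vectors. -/
noncomputable def Matrix.baseChangeEnd : Matrix n n F →ₐ[F] Module.End K (n → K) :=
  ((Matrix.toLinAlgEquiv' (R := K) (n := n)).toAlgHom.restrictScalars F).comp
    (Algebra.ofId F K).mapMatrix

theorem adjoin_image_baseChangeEnd_eq_top {S : Set (Matrix n n F)}
    (hS : Algebra.adjoin F S = ⊤) :
    Algebra.adjoin K (Matrix.baseChangeEnd F K n '' S) = ⊤ := by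
  have hF (M : Matrix n n F) :
      Matrix.baseChangeEnd F K n M ∈ Algebra.adjoin K (Matrix.baseChangeEnd F K n '' S) := by
    have : Algebra.adjoin F S ≤ ((Algebra.adjoin K
        (Matrix.baseChangeEnd F K n '' S)).restrictScalars F).comap (Matrix.baseChangeEnd F K n) :=
      Algebra.adjoin_le fun M hM ↦ Algebra.subset_adjoin (Set.mem_image_of_mem _ hM)
    rw [hS] at this
    exact this Algebra.mem_top
  rw [Algebra.eq_top_iff]
  intro f
  obtain ⟨M, rfl⟩ := (Matrix.toLinAlgEquiv' (R := K) (n := n)).surjective f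
  rw [Matrix.matrix_eq_sum_single M, map_sum]
  refine sum_mem fun i _ ↦ ?_
  rw [map_sum]
  refine sum_mem fun j _ ↦ ?_
  have : Matrix.toLinAlgEquiv' (Matrix.single i j (M i j)) =
      M i j • Matrix.baseChangeEnd F K n (Matrix.single i j 1) := by
    rw [Matrix.baseChangeEnd]
    simp [← map_smul, Matrix.map_single]
  rw [this]
  exact Subalgebra.smul_mem _ (hF _) _

theorem adjoin_eq_top_of_adjoin_image_baseChangeEnd_eq_top {T : Set (Matrix n n F)}
    (hT : Algebra.adjoin K (Matrix.baseChangeEnd F K n '' T) = ⊤) :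
    Algebra.adjoin F T = ⊤ := by
  by_contra hne
  obtain ⟨f, hf0, hf⟩ := Submodule.exists_le_ker_of_lt_top
    (Subalgebra.toSubmodule (Algebra.adjoin F T)) (lt_top_iff_ne_top.2 (by simpa using hne))
  let g : Matrix n n K →ₗ[K] K :=
    ∑ i, ∑ j, algebraMap F K (f (Matrix.single i j 1)) • Matrix.entryLinearMap K K i j
  have hg (M : Matrix n n F) : g (M.map (algebraMap F K)) = algebraMap F K (f M) := by
    conv_rhs => rw [Matrix.matrix_eq_sum_single M]
    have hij (i j : n) : f (Matrix.single i j (M i j)) = f (Matrix.single i j 1) * M i j := by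
      rw [mul_comm, ← smul_eq_mul, ← map_smul]
      simp
    simp [g, hij, Algebra.smul_def]
  let g' : Module.End K (n → K) →ₗ[K] K :=
    g ∘ₗ (Matrix.toLinAlgEquiv' (R := K) (n := n)).symm.toLinearMap
  have hg' (M : Matrix n n F) : g' (Matrix.baseChangeEnd F K n M) = algebraMap F K (f M) := by
    rw [← hg]
    simp [g', Matrix.baseChangeEnd]
    rfl
  have hker : (⊤ : Submodule K (Module.End K (n → K))) ≤ LinearMap.ker g' := by
    rw [← Algebra.top_toSubmodule, ← hT, Algebra.adjoin_eq_span, Submodule.span_le]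
    have himg : Matrix.baseChangeEnd F K n '' T =
      (Matrix.baseChangeEnd F K n : _ →* Module.End K (n → K)) '' T := rfl
    rw [himg, ← MonoidHom.map_mclosure]
    rintro _ ⟨M, hM, rfl⟩
    have hfM : f M = 0 := hf ((Algebra.adjoin_eq_span F T).ge (Submodule.subset_span hM))
    exact (hg' M).trans (by rw [hfM, map_zero])
  refine hf0 (LinearMap.ext fun M ↦ (algebraMap F K).injective ?_)
  rw [← hg', LinearMap.zero_apply, map_zero]
  exact hker Submodule.mem_top

end BaseChange

theorem stmt_4 (F : Type*) [Field F] (n : ℕ) (hn : 0 < n)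
    (S : Set (Matrix (Fin n) (Fin n) F))
    (hgen : Algebra.adjoin F S = ⊤)
    (hirr : ∀ T ⊂ S, Algebra.adjoin F T ≠ ⊤) :
    S.Finite ∧ S.ncard ≤ 2 * n - 1 := by
  classical
  have : NeZero n := ⟨hn.ne'⟩
  obtain ⟨T', hT'S, hT', hcard⟩ := exists_finset_card_lt_adjoin_eq_top
    (adjoin_image_baseChangeEnd_eq_top (K := AlgebraicClosure F) hgen)
  obtain ⟨T, hTS, hinj, rfl⟩ := Finset.exists_subset_injOn_image_eq_of_surjOn S T' hT'S
  rw [Finset.card_image_of_injOn hinj] at hcard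
  rw [Finset.coe_image] at hT'
  have hT := adjoin_eq_top_of_adjoin_image_baseChangeEnd_eq_top hT'
  have hST : (T : Set _) = S := by
    by_contra hne
    exact hirr _ (hTS.ssubset_of_ne hne) hT
  rw [← hST]
  refine ⟨T.finite_toSet, ?_⟩
  rw [Module.finrank_fin_fun] at hcard
  rw [Set.ncard_coe_finset]
  omega
end

section
/- For n > 1, the largest irredundant generating sets for M_n(F) have exactly 2n−1 elements; that is, there exists an irredundant generating set of size 2n−1 and every irredundant generating set has at most 2n−1 elements. -/
section Length

variable {R R' X X' : Type*} [Ring R] [Ring R'] [AddCommGroup X] [AddCommGroup X']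
  [Module R X] [Module R' X']

theorem Module.length_eq_height_add_coheight (N : Submodule R X) :
    Module.length R X = Order.height N + Order.coheight N := by
  rw [← Module.length_submodule, ← Module.length_quotient]
  exact Module.length_eq_add_of_exact N.subtype N.mkQ N.subtype_injective N.mkQ_surjective
    (LinearMap.exact_subtype_mkQ N)

/-- Pull a submodule back along an additive map through which scalars can be transported. -/
def Submodule.pullback (e : X →+ X') (h : ∀ r : R, ∃ r' : R', ∀ x, e (r • x) = r' • e x)
    (N : Submodule R' X') : Submodule R X where
  carrier := e ⁻¹' N
  add_mem' := by
    intro a b ha hb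
    simpa using N.add_mem ha hb
  zero_mem' := by simp
  smul_mem' := by
    intro r x hx
    obtain ⟨r', hr'⟩ := h r
    simpa [hr'] using N.smul_mem r' hx

@[simp]
theorem Submodule.mem_pullback (e : X →+ X')
    (h : ∀ r : R, ∃ r' : R', ∀ x, e (r • x) = r' • e x) (N : Submodule R' X') (x : X) :
    x ∈ N.pullback e h ↔ e x ∈ N := Iff.rfl

theorem Submodule.pullback_strictMono (e : X →+ X') (he : Function.Surjective e)
    (h : ∀ r : R, ∃ r' : R', ∀ x, e (r • x) = r' • e x) :
    StrictMono (Submodule.pullback (R := R) (R' := R') e h) := by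
  intro N P hNP
  refine lt_of_le_of_ne (fun x hx => hNP.le hx) fun heq => hNP.ne ?_
  ext y
  obtain ⟨x, rfl⟩ := he y
  exact SetLike.ext_iff.mp heq x

theorem Module.length_le_of_pullback (e : X →+ X') (he : Function.Surjective e)
    (h : ∀ r : R, ∃ r' : R', ∀ x, e (r • x) = r' • e x) :
    Module.length R' X' ≤ Module.length R X := by
  rw [← WithBot.coe_le_coe, Module.coe_length, Module.coe_length]
  exact Order.krullDim_le_of_strictMono _ (Submodule.pullback_strictMono e he h)

/-- The length drops strictly if no simple submodule stays simple for the smaller ring. -/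
theorem Module.length_add_one_le_of_pullback [IsArtinian R' X'] [Nontrivial X']
    (e : X →+ X') (he : Function.Bijective e)
    (h : ∀ r : R, ∃ r' : R', ∀ x, e (r • x) = r' • e x)
    (hns : ∀ N : Submodule R' X', N ≠ ⊥ → ¬ IsSimpleModule R (N.pullback e h)) :
    Module.length R' X' + 1 ≤ Module.length R X := by
  obtain ⟨N, hN, -⟩ := (eq_bot_or_exists_atom_le (⊤ : Submodule R' X')).resolve_left top_ne_bot
  have hsimple : IsSimpleModule R' N := isSimpleModule_iff_isAtom.mpr hN
  have h1 : Order.height N = 1 := by rw [← Module.length_submodule, Module.length_eq_one]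
  have h2 : 2 ≤ Order.height (N.pullback e h) := by
    have hne := hns N hN.1
    rw [← Module.length_eq_one_iff, Module.length_submodule] at hne
    have hle : 1 ≤ Order.height (N.pullback e h) :=
      h1 ▸ Order.height_le_height_apply_of_strictMono _
        (Submodule.pullback_strictMono e he.surjective h) N
    exact Order.add_one_le_of_lt (lt_of_le_of_ne hle (Ne.symm hne))
  have h3 : Order.coheight N ≤ Order.coheight (N.pullback e h) :=
    Order.coheight_le_coheight_apply_of_strictMono _
      (Submodule.pullback_strictMono e he.surjective h) N
  rw [Module.length_eq_height_add_coheight N, Module.length_eq_height_add_coheight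
    (N.pullback e h), h1, add_right_comm, one_add_one_eq_two]
  exact add_le_add h2 h3

end Length

/-- **Burnside's theorem** on irreducible actions over an algebraically closed field. -/
theorem IsSimpleModule.exists_smul_eq_of_isAlgClosed {F R X : Type*} [Field F] [IsAlgClosed F]
    [Ring R] [Algebra F R] [AddCommGroup X] [Module F X] [Module R X] [IsScalarTower F R X]
    [FiniteDimensional F X] [IsSimpleModule R X] (g : Module.End F X) :
    ∃ r : R, ∀ x, g x = r • x := by
  have : SMulCommClass R F X := IsScalarTower.to_smulCommClass'
  have hscalar : ∀ φ : Module.End R X, ∃ c : F, ∀ x, φ x = c • x := by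
    intro φ
    have := IsSimpleModule.nontrivial R X
    obtain ⟨c, hc⟩ := Module.End.exists_eigenvalue (φ.restrictScalars F)
    obtain ⟨v, hv⟩ := hc.exists_hasEigenvector
    let K : Submodule R X :=
      { carrier := {x | φ x = c • x}
        add_mem' := fun {x y} hx hy => by simp_all
        zero_mem' := by simp
        smul_mem' := fun r x hx => by
          simp only [Set.mem_ofPred_eq] at hx ⊢
          rw [map_smul, hx, smul_comm] }
    have hK : K = ⊤ := (eq_bot_or_eq_top K).resolve_left fun hb =>
      hv.2 ((Submodule.mem_bot R).mp (hb ▸ (show v ∈ K from hv.apply_eq_smul)))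
    exact ⟨c, fun x => (show x ∈ K from hK ▸ Submodule.mem_top)⟩
  let G : Module.End (Module.End R X) X :=
    { toFun := g
      map_add' := map_add g
      map_smul' := by
        intro φ x
        obtain ⟨c, hc⟩ := hscalar φ
        simp [hc] }
  obtain ⟨s, hs⟩ := Module.Finite.fg_top (R := F) (M := X)
  obtain ⟨r, hr⟩ := jacobson_density (R := R) G s
  refine ⟨r, fun x => ?_⟩
  have hx : x ∈ Submodule.span F (s : Set X) := hs ▸ Submodule.mem_top
  induction hx using Submodule.span_induction with
  | mem m hm => exact hr m hm
  | zero => simp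
  | add _ _ _ _ h₁ h₂ => simp [h₁, h₂]
  | smul c _ _ h => rw [map_smul, h, smul_comm]

section Operators

variable {F V ι : Type*} [Field F] [AddCommGroup V] [Module F V]

/-- An algebra of operators is degenerate if one of its nonzero elements kills a nonzero
submodule. -/
def Subalgebra.IsDegenerate (A : Subalgebra F (Module.End F V)) : Prop :=
  ∃ a ∈ A, a ≠ 0 ∧ ∃ x ≠ 0, ∀ c ∈ A, a (c x) = 0

/-- The algebra generated by `A` and the operators `f i` for `i ∈ T`. -/
def Subalgebra.extend (A : Subalgebra F (Module.End F V)) (f : ι → Module.End F V) (T : Set ι) :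
    Subalgebra F (Module.End F V) :=
  A ⊔ Algebra.adjoin F (f '' T)

/-- The operators preserving a subspace. -/
def Submodule.stabilizer (W : Submodule F V) : Subalgebra F (Module.End F V) where
  carrier := {a | ∀ v ∈ W, a v ∈ W}
  mul_mem' := fun ha hb v hv => ha _ (hb v hv)
  add_mem' := fun ha hb v hv => W.add_mem (ha v hv) (hb v hv)
  algebraMap_mem' := fun c v hv => by
    simpa [Module.algebraMap_end_apply] using W.smul_mem c hv

namespace Subalgebra

variable {A B : Subalgebra F (Module.End F V)} {f : ι → Module.End F V} {T T' : Set ι}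

theorem le_extend : A ≤ A.extend f T := le_sup_left

theorem apply_mem_extend {i : ι} (hi : i ∈ T) : f i ∈ A.extend f T :=
  (le_sup_right : _ ≤ A.extend f T) (Algebra.subset_adjoin ⟨i, hi, rfl⟩)

theorem extend_le (hA : A ≤ B) (hf : ∀ i ∈ T, f i ∈ B) : A.extend f T ≤ B :=
  sup_le hA (Algebra.adjoin_le (by rintro _ ⟨i, hi, rfl⟩; exact hf i hi))

theorem extend_mono (h : T ⊆ T') : A.extend f T ≤ A.extend f T' :=
  extend_le le_extend fun _ hi => apply_mem_extend (h hi)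

theorem extend_extend_le : (A.extend f T).extend f T' ≤ A.extend f (T ∪ T') :=
  extend_le (extend_mono Set.subset_union_left) fun _ hi => apply_mem_extend (Or.inr hi)

/-- A subspace stable under `A`, as an `A`-submodule. -/
def toSubmoduleOfLe (W : Submodule F V) (h : A ≤ W.stabilizer) : Submodule A V where
  __ := W
  smul_mem' := fun a v hv => h a.2 v hv

@[simp]
theorem mem_toSubmoduleOfLe {W : Submodule F V} {h : A ≤ W.stabilizer} {v : V} :
    v ∈ toSubmoduleOfLe W h ↔ v ∈ W := Iff.rfl

theorem le_stabilizer (W : Submodule A V) : A ≤ (W.restrictScalars F).stabilizer :=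
  fun a ha _ hv => W.smul_mem ⟨a, ha⟩ hv

instance isScalarTowerEnd : IsScalarTower F A V := ⟨fun _ _ _ => rfl⟩

theorem length_antitone (h : A ≤ B) : Module.length B V ≤ Module.length A V :=
  Module.length_le_of_pullback (AddMonoidHom.id V) Function.surjective_id
    fun r => ⟨⟨r, h r.2⟩, fun _ => rfl⟩

theorem isArtinian_of_finiteDimensional [FiniteDimensional F V] : IsArtinian A V :=
  isArtinian_of_tower F inferInstance

theorem isNoetherian_of_finiteDimensional [FiniteDimensional F V] : IsNoetherian A V :=
  isNoetherian_of_tower F inferInstance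

theorem IsDegenerate.two_le_length [FiniteDimensional F V] (hA : A.IsDegenerate) :
    2 ≤ Module.length A V := by
  obtain ⟨a, haA, ha0, x, hx0, hax⟩ := hA
  have : Nontrivial V := ⟨x, 0, hx0⟩
  have h1 : 1 ≤ Module.length A V := Order.one_le_iff_pos.mpr Module.length_pos
  refine Order.add_one_le_of_lt (lt_of_le_of_ne h1 fun h => ha0 ?_)
  have hs : IsSimpleModule A V := Module.length_eq_one_iff.mp h.symm
  ext y
  obtain ⟨c, rfl⟩ := (IsSimpleModule.toSpanSingleton_surjective A hx0) y
  exact hax c c.2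

theorem eq_top_of_isSimpleModule_s5 [IsAlgClosed F] [FiniteDimensional F V] [IsSimpleModule A V] :
    A = ⊤ := by
  rw [eq_top_iff]
  intro g _
  obtain ⟨a, ha⟩ := IsSimpleModule.exists_smul_eq_of_isAlgClosed (R := A) g
  have : g = a := LinearMap.ext ha
  exact this ▸ a.2

/-- A nondegenerate algebra is no larger than a subalgebra acting irreducibly on one of its
submodules. -/
theorem le_of_isSimpleModule [IsAlgClosed F] [FiniteDimensional F V] (hAB : A ≤ B)
    (hB : ¬ B.IsDegenerate) {X : Type*} [AddCommGroup X] [Module A X] [IsSimpleModule A X]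
    (j : X →ₗ[A] V) (hj : Function.Injective j) (hr : ∀ b ∈ B, ∀ x, b (j x) ∈ LinearMap.range j) :
    B ≤ A := by
  intro b hb
  let N : Submodule A V := LinearMap.range j
  let e : X ≃ₗ[A] N := LinearEquiv.ofInjective j hj
  have : IsSimpleModule A N := IsSimpleModule.congr e.symm
  have : FiniteDimensional F N := inferInstanceAs (FiniteDimensional F (N.restrictScalars F))
  have hN : ∀ b ∈ B, ∀ v ∈ N, b v ∈ N := by
    rintro b hb _ ⟨x, rfl⟩
    exact hr b hb x
  let g : Module.End F N :=
    b.restrict (p := N.restrictScalars F) (q := N.restrictScalars F) (hN b hb)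
  obtain ⟨a, ha⟩ :=
    IsSimpleModule.exists_smul_eq_of_isAlgClosed (F := F) (R := A) (X := N) g
  have hba : ∀ v ∈ N, b v = (a : Module.End F V) v := fun v hv =>
    congrArg Subtype.val (ha ⟨v, hv⟩)
  have hsub : b - a = 0 := by
    by_contra hne
    have := IsSimpleModule.nontrivial A N
    obtain ⟨⟨x, hx⟩, hx0⟩ := exists_ne (0 : N)
    refine hB ⟨b - a, B.sub_mem hb (hAB a.2), hne, x, fun h => hx0 (Subtype.ext h), ?_⟩
    intro c hc
    rw [LinearMap.sub_apply, hba _ (hN c hc x hx), sub_self]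
  rw [sub_eq_zero.mp hsub]
  exact a.2

theorem length_add_one_le [IsAlgClosed F] [FiniteDimensional F V] (hAB : A ≤ B) (hne : A ≠ B)
    (hB : ¬ B.IsDegenerate) {X X' : Type*} [AddCommGroup X] [AddCommGroup X'] [Module A X]
    [Module B X'] [IsArtinian B X'] [Nontrivial X'] (e : X ≃+ X') (j : X →ₗ[A] V)
    (j' : X' →ₗ[B] V) (hj' : Function.Injective j') (h : ∀ x, j' (e x) = j x) :
    Module.length B X' + 1 ≤ Module.length A X := by
  have hsmul : ∀ a : A, ∃ b : B, ∀ x, e (a • x) = b • e x := fun a =>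
    ⟨⟨a, hAB a.2⟩, fun x => hj' (by rw [h, map_smul, map_smul, h]; rfl)⟩
  have hj : Function.Injective j := fun x y hxy =>
    e.injective (hj' (by rw [h, h, hxy]))
  refine Module.length_add_one_le_of_pullback (e : X →+ X') e.bijective hsmul ?_
  intro N _ hs
  obtain ⟨P, hP⟩ : ∃ P, P = N.pullback (e : X →+ X') hsmul := ⟨_, rfl⟩
  rw [← hP] at hs
  have hmem : ∀ x, x ∈ P ↔ e x ∈ N := fun x => by rw [hP]; rfl
  refine hne (le_antisymm hAB ?_)
  refine le_of_isSimpleModule (X := P) hAB hB (j.comp P.subtype)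
    (hj.comp P.injective_subtype) ?_
  rintro b hb ⟨x, hx⟩
  have hy : e (e.symm ((⟨b, hb⟩ : B) • e x)) ∈ N := by
    rw [e.apply_symm_apply]
    exact N.smul_mem _ ((hmem x).mp hx)
  have hj1 : j (e.symm ((⟨b, hb⟩ : B) • e x)) = b (j x) := by
    rw [← h, ← h, e.apply_symm_apply, map_smul]
    rfl
  exact ⟨⟨e.symm ((⟨b, hb⟩ : B) • e x), (hmem _).mpr hy⟩, hj1⟩

/-- Passing to a strictly larger nondegenerate algebra strictly decreases the length of every
nonzero submodule. -/
theorem height_add_one_le [IsAlgClosed F] [FiniteDimensional F V] (hAB : A ≤ B) (hne : A ≠ B)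
    (hB : ¬ B.IsDegenerate) (M : Submodule F V) (hM : M ≠ ⊥) (hBM : B ≤ M.stabilizer) :
    Order.height (toSubmoduleOfLe M hBM) + 1 ≤
      Order.height (toSubmoduleOfLe M (hAB.trans hBM)) := by
  rw [← Module.length_submodule, ← Module.length_submodule]
  have := isArtinian_of_finiteDimensional (A := B)
  have : Nontrivial (toSubmoduleOfLe M hBM) := by
    obtain ⟨x, hx, hx0⟩ := M.ne_bot_iff.mp hM
    exact ⟨⟨x, hx⟩, 0, fun h => hx0 (congrArg Subtype.val h)⟩
  let e : toSubmoduleOfLe M (hAB.trans hBM) ≃+ toSubmoduleOfLe M hBM :=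
    { toFun := fun x => ⟨x.1, x.2⟩
      invFun := fun x => ⟨x.1, x.2⟩
      left_inv := fun _ => rfl
      right_inv := fun _ => rfl
      map_add' := fun _ _ => rfl }
  exact length_add_one_le hAB hne hB e (Submodule.subtype _) (Submodule.subtype _)
    (Submodule.injective_subtype _) fun _ => rfl

theorem stabilizer_ne_bot_eq_top {W : Submodule F V} (hW : W ≠ ⊥) (h : W.stabilizer = ⊤) :
    W = ⊤ := by
  obtain ⟨x, hx, hx0⟩ := W.ne_bot_iff.mp hW
  have : Nontrivial V := ⟨x, 0, hx0⟩
  rw [eq_top_iff]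
  intro y _
  obtain ⟨g, rfl⟩ := IsSimpleModule.toSpanSingleton_surjective (Module.End F V) hx0 y
  exact (h ▸ Algebra.mem_top : g ∈ W.stabilizer) x hx

/-- Few operators suffice to make a given nonzero vector cyclic. -/
theorem exists_finset_cyclic [DecidableEq ι] [FiniteDimensional F V] {k : ℕ}
    (hk : Module.length A V ≤ k) (hT : A.extend f T = ⊤) {v : V} (hv : v ≠ 0) :
    ∃ S : Finset ι, ↑S ⊆ T ∧ S.card + 1 ≤ k ∧
      ∀ W : Submodule F V, A.extend f S ≤ W.stabilizer → v ∈ W → W = ⊤ := by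
  have := isArtinian_of_finiteDimensional (A := A)
  have := isNoetherian_of_finiteDimensional (A := A)
  have key : ∀ (j : ℕ) (U : Submodule A V), U ≠ ⊥ → (k : ℕ∞) ≤ Order.height U + j →
      ∃ S : Finset ι, ↑S ⊆ T ∧ S.card ≤ j ∧
        ∀ W : Submodule F V, A.extend f S ≤ W.stabilizer → (∀ u ∈ U, u ∈ W) → W = ⊤ := by
    intro j
    induction j with
    | zero =>
      intro U _ hU
      refine ⟨∅, by simp, le_rfl, fun W _ hUW => ?_⟩
      have hUtop : U = ⊤ := by
        by_contra h
        have h1 := Submodule.length_lt h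
        rw [Module.length_submodule] at h1
        exact absurd (hk.trans (by simpa using hU)) (not_le.mpr h1)
      rw [eq_top_iff]
      exact fun x _ => hUW x (hUtop ▸ Submodule.mem_top)
    | succ j ih =>
      intro U hU hkU
      by_cases hall : ∀ i ∈ T, f i ∈ (U.restrictScalars F).stabilizer
      · have htop : (U.restrictScalars F).stabilizer = ⊤ :=
          top_le_iff.mp (hT ▸ extend_le (le_stabilizer U) hall)
        have hUtop := stabilizer_ne_bot_eq_top (by simpa using hU) htop
        refine ⟨∅, by simp, by simp, fun W _ hUW => ?_⟩
        rw [eq_top_iff, ← hUtop]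
        exact hUW
      · push Not at hall
        obtain ⟨i, hiT, hi⟩ := hall
        simp only [Submodule.stabilizer] at hi
        have hi' : ∃ u ∈ U, f i u ∉ U := by
          by_contra hcon
          push Not at hcon
          exact hi hcon
        obtain ⟨u, huU, hu⟩ := hi'
        have hlt : U < U ⊔ Submodule.span A {f i u} :=
          lt_of_le_of_ne le_sup_left fun h => hu
            (h ▸ (le_sup_right : _ ≤ U ⊔ Submodule.span A {f i u})
              (Submodule.mem_span_singleton_self _))
        have hheight := Order.add_one_le_of_lt (Submodule.height_strictMono hlt)
        obtain ⟨S, hST, hSj, hS⟩ := ih (U ⊔ Submodule.span A {f i u}) (ne_bot_of_gt hlt) (by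
          refine hkU.trans ?_
          push_cast
          rw [add_comm (j : ℕ∞), ← add_assoc]
          gcongr)
        refine ⟨insert i S, ?_, (Finset.card_insert_le _ _).trans (by omega), ?_⟩
        · rw [Finset.coe_insert]
          exact Set.insert_subset hiT hST
        · intro W hW hUW
          refine hS W ((extend_mono (by simp)).trans hW) ?_
          have hle : U ⊔ Submodule.span A {f i u} ≤ toSubmoduleOfLe W (le_extend.trans hW) := by
            refine sup_le hUW ?_
            rw [Submodule.span_singleton_le_iff_mem]
            exact hW (apply_mem_extend (by simp)) u (hUW u huU)
          exact hle
  have hne : Submodule.span A {v} ≠ ⊥ := by simpa using hv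
  have h1 : 1 ≤ Order.height (Submodule.span A {v}) := by
    rw [Order.one_le_iff_pos, Order.height_pos, isMin_iff_eq_bot]
    exact hne
  have : Nontrivial V := ⟨v, 0, hv⟩
  have hk1 : 1 ≤ k := by
    exact_mod_cast (Order.one_le_iff_pos.mpr (Module.length_pos (R := A) (M := V))).trans hk
  obtain ⟨S, hST, hSj, hS⟩ := key (k - 1) _ hne (by
    calc (k : ℕ∞) = 1 + ((k - 1 : ℕ) : ℕ∞) := by norm_cast; omega
      _ ≤ _ := by gcongr)
  refine ⟨S, hST, by omega, fun W hW hvW => hS W hW ?_⟩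
  have hle : Submodule.span A {v} ≤ toSubmoduleOfLe W (le_extend.trans hW) := by
    rw [Submodule.span_singleton_le_iff_mem]
    exact hvW
  exact hle

end Subalgebra

end Operators

theorem IsCoatom.coheight_submodule {R X : Type*} [Ring R] [AddCommGroup X] [Module R X]
    {N : Submodule R X} (hN : IsCoatom N) : Order.coheight N = 1 := by
  rw [← Module.length_quotient, Module.length_eq_one_iff]
  exact isSimpleModule_iff_isCoatom.mpr hN

section Quotient

variable {F V ι : Type*} [Field F] [AddCommGroup V] [Module F V]

namespace Subalgebra

variable {A B : Subalgebra F (Module.End F V)} {f : ι → Module.End F V} {T : Set ι}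
  {M : Submodule F V}

/-- The operators on `V ⧸ M` induced by elements of `A`. -/
def quotientOperators (A : Subalgebra F (Module.End F V)) (M : Submodule F V) :
    Subalgebra F (Module.End F (V ⧸ M)) where
  carrier := {g | ∃ a ∈ A, ∀ v, g (M.mkQ v) = M.mkQ (a v)}
  mul_mem' := by
    rintro g g' ⟨a, ha, hg⟩ ⟨a', ha', hg'⟩
    exact ⟨a * a', A.mul_mem ha ha', fun v => by
      rw [Module.End.mul_apply, hg', hg, Module.End.mul_apply]⟩
  add_mem' := by
    rintro g g' ⟨a, ha, hg⟩ ⟨a', ha', hg'⟩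
    exact ⟨a + a', A.add_mem ha ha', fun v => by
      rw [LinearMap.add_apply, hg', hg, LinearMap.add_apply, map_add]⟩
  algebraMap_mem' := fun c => ⟨algebraMap F _ c, A.algebraMap_mem c, fun v => by
    rw [Module.algebraMap_end_apply, Module.algebraMap_end_apply, map_smul]⟩

/-- The operators on `V` inducing an element of `D` on `V ⧸ M`. -/
def liftOperators (M : Submodule F V) (D : Subalgebra F (Module.End F (V ⧸ M))) :
    Subalgebra F (Module.End F V) where
  carrier := {a | ∃ g ∈ D, ∀ v, g (M.mkQ v) = M.mkQ (a v)}
  mul_mem' := by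
    rintro a a' ⟨g, hgD, hg⟩ ⟨g', hgD', hg'⟩
    exact ⟨g * g', D.mul_mem hgD hgD', fun v => by
      rw [Module.End.mul_apply, hg', hg, Module.End.mul_apply]⟩
  add_mem' := by
    rintro a a' ⟨g, hgD, hg⟩ ⟨g', hgD', hg'⟩
    exact ⟨g + g', D.add_mem hgD hgD', fun v => by
      rw [LinearMap.add_apply, hg', hg, LinearMap.add_apply, map_add]⟩
  algebraMap_mem' := fun c => ⟨algebraMap F _ c, D.algebraMap_mem c, fun v => by
    rw [Module.algebraMap_end_apply, Module.algebraMap_end_apply, map_smul]⟩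

theorem exists_mem_quotientOperators (hA : A ≤ M.stabilizer) {a : Module.End F V} (ha : a ∈ A) :
    ∃ g ∈ A.quotientOperators M, ∀ v, g (M.mkQ v) = M.mkQ (a v) :=
  ⟨M.mapQ M a (hA ha), ⟨a, ha, fun _ => rfl⟩, fun _ => rfl⟩

theorem quotientOperators_extend_le (hA : A ≤ M.stabilizer)
    {g : ι → Module.End F (V ⧸ M)} (hg : ∀ i ∈ T, ∀ v, g i (M.mkQ v) = M.mkQ (f i v)) :
    (A.extend f T).quotientOperators M ≤ (A.quotientOperators M).extend g T := by
  have hle : A.extend f T ≤ liftOperators M ((A.quotientOperators M).extend g T) := by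
    refine extend_le (fun a ha => ?_) fun i hi => ⟨g i, apply_mem_extend hi, hg i hi⟩
    obtain ⟨b, hb, hba⟩ := exists_mem_quotientOperators hA ha
    exact ⟨b, le_extend hb, hba⟩
  rintro b ⟨a, ha, hba⟩
  obtain ⟨b', hb', hba'⟩ := hle ha
  have : b = b' := by
    ext v
    exact (hba v).trans (hba' v).symm
  exact this ▸ hb'

theorem extend_quotientOperators_le
    {g : ι → Module.End F (V ⧸ M)} (hg : ∀ i ∈ T, ∀ v, g i (M.mkQ v) = M.mkQ (f i v)) :
    (A.quotientOperators M).extend g T ≤ (A.extend f T).quotientOperators M :=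
  extend_le (fun _ ⟨a, ha, hba⟩ => ⟨a, le_extend ha, hba⟩)
    fun i hi => ⟨f i, apply_mem_extend hi, hg i hi⟩

theorem length_quotientOperators_le (hA : A ≤ M.stabilizer) :
    Module.length (A.quotientOperators M) (V ⧸ M) ≤ Order.coheight (toSubmoduleOfLe M hA) := by
  have hsmul : ∀ a : A, ∃ b : A.quotientOperators M, ∀ v : V,
      M.mkQ.toAddMonoidHom (a • v) = b • M.mkQ.toAddMonoidHom v := fun a => by
    obtain ⟨b, hb, hba⟩ := exists_mem_quotientOperators hA a.2
    exact ⟨⟨b, hb⟩, fun v => (hba v).symm⟩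
  have hbot : Submodule.pullback (R' := A.quotientOperators M) M.mkQ.toAddMonoidHom hsmul ⊥ =
      toSubmoduleOfLe M hA := by
    ext v
    simp
  rw [Module.length_eq_height_add_coheight ⊥, Order.height_bot, zero_add, ← hbot]
  exact Order.coheight_le_coheight_apply_of_strictMono _
    (Submodule.pullback_strictMono _ M.mkQ_surjective hsmul) _

theorem height_antitone (h : A ≤ B) (hB : B ≤ M.stabilizer) :
    Order.height (toSubmoduleOfLe M hB) ≤ Order.height (toSubmoduleOfLe M (h.trans hB)) :=
  Order.height_le_height_apply_of_strictMono _
    (Submodule.pullback_strictMono (R := A) (AddMonoidHom.id V) Function.surjective_id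
      fun r => ⟨⟨r, h r.2⟩, fun _ => rfl⟩) _

theorem quotientOperators_eq_top [IsAlgClosed F] [FiniteDimensional F V] (hA : A ≤ M.stabilizer)
    (hM : IsCoatom (toSubmoduleOfLe M hA)) : A.quotientOperators M = ⊤ := by
  have hne : M ≠ ⊤ := by
    rintro rfl
    exact hM.1 (eq_top_iff.mpr fun _ _ => trivial)
  have : Nontrivial (V ⧸ M) := Submodule.Quotient.nontrivial_iff.mpr hne
  have hsimple : IsSimpleModule (A.quotientOperators M) (V ⧸ M) := by
    rw [← Module.length_eq_one_iff]
    refine le_antisymm ((length_quotientOperators_le hA).trans ?_)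
      (Order.one_le_iff_pos.mpr Module.length_pos)
    rw [hM.coheight_submodule]
  exact eq_top_of_isSimpleModule_s5

theorem isCoatom_of_quotientOperators_eq_top (hA : A ≤ M.stabilizer) (hM : M ≠ ⊤)
    (h : A.quotientOperators M = ⊤) : IsCoatom (toSubmoduleOfLe M hA) := by
  refine ⟨fun htop => hM (eq_top_iff.mpr fun v _ => ?_), fun P hP => ?_⟩
  · exact (SetLike.ext_iff.mp htop v).mpr trivial
  · obtain ⟨hle, v, hv, hvM⟩ := SetLike.lt_iff_le_and_exists.mp hP
    rw [eq_top_iff]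
    intro w _
    have hv0 : M.mkQ v ≠ 0 := by simpa using hvM
    have : Nontrivial (V ⧸ M) := ⟨_, _, hv0⟩
    obtain ⟨g, hg⟩ :=
      IsSimpleModule.toSpanSingleton_surjective (Module.End F (V ⧸ M)) hv0 (M.mkQ w)
    obtain ⟨a, ha, hga⟩ : g ∈ A.quotientOperators M := h ▸ Algebra.mem_top
    have hsub : w - a v ∈ P := by
      refine hle ((Submodule.Quotient.eq M).mp ?_)
      exact hg.symm.trans (hga v)
    have hav : a v ∈ P := P.smul_mem ⟨a, ha⟩ hv
    simpa using P.add_mem hsub hav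

theorem not_isDegenerate_top : ¬ (⊤ : Subalgebra F (Module.End F V)).IsDegenerate := by
  rintro ⟨a, -, ha, x, hx, h⟩
  refine ha (LinearMap.ext fun y => ?_)
  have : Nontrivial V := ⟨x, 0, hx⟩
  obtain ⟨g, rfl⟩ := IsSimpleModule.toSpanSingleton_surjective (Module.End F V) hx y
  exact h g trivial

theorem isDegenerate_quotientOperators (hA : A ≤ M.stabilizer) {a : Module.End F V} (ha : a ∈ A)
    {x y : V} (hy : a y ∉ M) (hx : x ∉ M) (h : ∀ c ∈ A, a (c x) = 0) :
    (A.quotientOperators M).IsDegenerate := by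
  obtain ⟨b, hb, hba⟩ := exists_mem_quotientOperators hA ha
  refine ⟨b, hb, ?_, M.mkQ x, by simpa using hx, ?_⟩
  · rintro rfl
    refine hy ?_
    have := hba y
    rwa [LinearMap.zero_apply, eq_comm, Submodule.mkQ_apply, Submodule.Quotient.mk_eq_zero] at this
  · rintro g ⟨c, hc, hgc⟩
    rw [hgc, hba, h c hc, map_zero]

end Subalgebra

end Quotient

section UpperBound

namespace Subalgebra

theorem exists_finset_extend_eq_top_aux {F V ι : Type*} [Field F] [IsAlgClosed F]
    [AddCommGroup V] [Module F V] [FiniteDimensional F V] [Nontrivial V] [DecidableEq ι]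
    {f : ι → Module.End F V} {T : Set ι} (k : ℕ)
    (H : ∀ j ≤ k, ∀ A : Subalgebra F (Module.End F V), A.extend f T = ⊤ → A.IsDegenerate →
      Module.length A V ≤ j → ∃ S : Finset ι, ↑S ⊆ T ∧ A.extend f S = ⊤ ∧ S.card + 2 ≤ 2 * j)
    (A : Subalgebra F (Module.End F V)) (hT : A.extend f T = ⊤) (hk : Module.length A V ≤ k) :
    ∃ S : Finset ι, ↑S ⊆ T ∧ A.extend f S = ⊤ ∧ S.card + 1 ≤ 2 * k := by
  induction k generalizing A with
  | zero => exact absurd (Module.length_pos (R := A) (M := V)) (not_lt.mpr hk)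
  | succ k ih =>
    by_cases htop : A = ⊤
    · exact ⟨∅, by simp, top_le_iff.mp (htop.symm.le.trans le_extend), by simp; omega⟩
    by_cases hA : A.IsDegenerate
    · obtain ⟨S, hS, hSA, hc⟩ := H _ le_rfl A hT hA hk
      exact ⟨S, hS, hSA, by omega⟩
    obtain ⟨i, hiT, hi⟩ : ∃ i ∈ T, f i ∉ A := by
      by_contra! hcon
      exact htop (top_le_iff.mp (hT.symm.le.trans (extend_le le_rfl hcon)))
    have hT' : (A.extend f {i}).extend f T = ⊤ :=
      top_le_iff.mp (hT.symm.le.trans (extend_le (le_extend.trans le_extend)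
        fun _ hj => apply_mem_extend hj))
    obtain ⟨S, hST, hS, hc⟩ : ∃ S : Finset ι, ↑S ⊆ T ∧ (A.extend f {i}).extend f S = ⊤ ∧
        S.card + 2 ≤ 2 * (k + 1) := by
      by_cases hA' : (A.extend f {i}).IsDegenerate
      · exact H _ le_rfl _ hT' hA' ((length_antitone le_extend).trans hk)
      · have hne : A ≠ A.extend f {i} := fun h => hi (h ▸ apply_mem_extend rfl)
        have := isArtinian_of_finiteDimensional (A := A.extend f {i})
        have hlt := (length_add_one_le le_extend hne hA' (AddEquiv.refl V) LinearMap.id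
          LinearMap.id Function.injective_id fun _ => rfl).trans hk
        obtain ⟨S, hST, hS, hc⟩ := ih (fun j hj => H j (hj.trans k.le_succ)) _ hT'
          ((ENat.add_le_add_iff_right ENat.one_ne_top).mp (by exact_mod_cast hlt))
        exact ⟨S, hST, hS, by omega⟩
    refine ⟨insert i S, ?_, ?_, (Nat.succ_le_succ (Finset.card_insert_le _ _)).trans hc⟩
    · rw [Finset.coe_insert]
      exact Set.insert_subset hiT hST
    · rw [Finset.coe_insert]
      exact top_le_iff.mp (hS.symm.le.trans extend_extend_le)

universe u

theorem exists_finset_extend_eq_top_of_isDegenerate {F ι : Type*} [Field F] [IsAlgClosed F]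
    [DecidableEq ι] (k : ℕ) {V : Type u} [AddCommGroup V] [Module F V] [FiniteDimensional F V]
    (f : ι → Module.End F V) (T : Set ι) (A : Subalgebra F (Module.End F V))
    (hT : A.extend f T = ⊤) (hA : A.IsDegenerate) (hk : Module.length A V ≤ k) :
    ∃ S : Finset ι, ↑S ⊆ T ∧ A.extend f S = ⊤ ∧ S.card + 2 ≤ 2 * k := by
  induction k using Nat.strong_induction_on generalizing V T with
  | _ k ih =>
  obtain ⟨a, haA, ha0, x, hx0, hax⟩ := id hA
  obtain ⟨y, hy⟩ : ∃ y, a y ≠ 0 := by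
    by_contra! h
    exact ha0 (LinearMap.ext h)
  have : Nontrivial V := ⟨_, _, hy⟩
  obtain ⟨T₁, hT₁, hc₁, h₁⟩ := exists_finset_cyclic hk hT hy
  obtain ⟨T₂, hT₂, hc₂, h₂⟩ := exists_finset_cyclic hk hT hx0
  have hcU := Finset.card_union_le T₁ T₂
  by_cases hB : A.extend f ↑(T₁ ∪ T₂) = ⊤
  · exact ⟨T₁ ∪ T₂, by simp [hT₁, hT₂], hB, by omega⟩
  have := isNoetherian_of_finiteDimensional (A := A.extend f ↑(T₁ ∪ T₂))
  obtain ⟨N, hN, -⟩ := (eq_top_or_exists_le_coatom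
    (⊥ : Submodule (A.extend f ↑(T₁ ∪ T₂)) V)).resolve_left bot_ne_top
  obtain ⟨M, hBM, hM⟩ : ∃ (M : Submodule F V) (h : A.extend f ↑(T₁ ∪ T₂) ≤ M.stabilizer),
    IsCoatom (toSubmoduleOfLe M h) := ⟨N.restrictScalars F, le_stabilizer N, hN⟩
  have hMtop : M ≠ ⊤ := by
    rintro rfl
    exact hM.1 (eq_top_iff.mpr fun _ _ => trivial)
  have hMbot : M ≠ ⊥ := by
    rintro rfl
    have : IsSimpleModule (A.extend f ↑(T₁ ∪ T₂)) V := by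
      have := isSimpleModule_iff_isCoatom.mpr hM
      exact IsSimpleModule.congr
        (Submodule.quotEquivOfEqBot (toSubmoduleOfLe ⊥ hBM) rfl).symm
    exact hB eq_top_of_isSimpleModule_s5
  have hayM : a y ∉ M := fun h => hMtop (h₁ M ((extend_mono (by simp)).trans hBM) h)
  have hxM : x ∉ M := fun h => hMtop (h₂ M ((extend_mono (by simp)).trans hBM) h)
  have hAM : A ≤ M.stabilizer := le_extend.trans hBM
  have hAq := isDegenerate_quotientOperators hAM haA hayM hxM hax
  classical
  let g : ι → Module.End F (V ⧸ M) := fun i =>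
    if hi : f i ∈ M.stabilizer then M.mapQ M (f i) hi else 0
  have hg : ∀ i ∈ (↑(T₁ ∪ T₂) : Set ι), ∀ v, g i (M.mkQ v) = M.mkQ (f i v) := by
    intro i hi v
    simp only [g, dif_pos (hBM (apply_mem_extend hi))]
    rfl
  have hqtop : (A.quotientOperators M).extend g ↑(T₁ ∪ T₂) = ⊤ := by
    rw [← top_le_iff, ← quotientOperators_eq_top hBM hM]
    exact quotientOperators_extend_le hAM hg
  have hsum := (Module.length_eq_height_add_coheight (toSubmoduleOfLe M hAM)).symm.le.trans hk
  obtain ⟨h, hh⟩ := ENat.ne_top_iff_exists.mp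
    (ne_top_of_le_ne_top (ENat.natCast_ne_top k) (le_self_add.trans hsum))
  have hcle := length_quotientOperators_le hAM
  obtain ⟨c, hc⟩ := ENat.ne_top_iff_exists.mp
    (ne_top_of_le_ne_top (ENat.natCast_ne_top k) (hcle.trans (le_add_self.trans hsum)))
  have hhc : h + c ≤ k := by
    have := (add_le_add hh.le (hc.le.trans hcle)).trans hsum
    exact_mod_cast this
  have hh1 : 1 ≤ h := by
    have : 1 ≤ Order.height (toSubmoduleOfLe M hAM) := by
      rw [Order.one_le_iff_pos, Order.height_pos, isMin_iff_eq_bot]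
      rintro hbot
      exact hMbot (eq_bot_iff.mpr fun v hv => (SetLike.ext_iff.mp hbot v).mp hv)
    rw [← hh] at this
    exact_mod_cast this
  have hc2 : 2 ≤ c := by
    have := hAq.two_le_length
    rw [← hc] at this
    exact_mod_cast this
  obtain ⟨S, hS, hSq, hcS⟩ := ih c (by omega) g _ _ hqtop hAq hc.symm.le
  have hle : A.extend f S ≤ A.extend f ↑(T₁ ∪ T₂) := extend_mono hS
  have hST : ↑S ⊆ T := hS.trans (by simp [hT₁, hT₂])
  have hBq : (A.extend f S).quotientOperators M = ⊤ :=
    top_le_iff.mp (hSq.symm.le.trans (extend_quotientOperators_le fun i hi => hg i (hS hi)))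
  have hM' := isCoatom_of_quotientOperators_eq_top (hle.trans hBM) hMtop hBq
  have hT' : (A.extend f S).extend f T = ⊤ :=
    top_le_iff.mp (hT.symm.le.trans (extend_le (le_extend.trans le_extend)
      fun _ hj => apply_mem_extend hj))
  have hlen := Module.length_eq_height_add_coheight (toSubmoduleOfLe M (hle.trans hBM))
  rw [hM'.coheight_submodule] at hlen
  obtain ⟨S', hS'T, hS', hcS'⟩ : ∃ S' : Finset ι, ↑S' ⊆ T ∧ (A.extend f S).extend f S' = ⊤ ∧
      S'.card ≤ 2 * h := by
    by_cases hdeg : (A.extend f S).IsDegenerate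
    · obtain ⟨S', h1, h2, h3⟩ := ih (h + 1) (by omega) f T _ hT' hdeg (by
        rw [hlen]
        push_cast
        rw [hh]
        gcongr
        exact height_antitone le_extend (hle.trans hBM))
      exact ⟨S', h1, h2, by omega⟩
    · have hne : A ≠ A.extend f S := by
        intro heq
        rw [← heq] at hBq
        exact not_isDegenerate_top (hBq ▸ hAq)
      obtain ⟨S', h1, h2, h3⟩ := exists_finset_extend_eq_top_aux h
        (fun j hj B hB hBd hBj => ih j (by omega) f T B hB hBd hBj) _ hT' (by
          rw [hlen, hh]
          exact height_add_one_le le_extend hne hdeg M hMbot (hle.trans hBM))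
      exact ⟨S', h1, h2, by omega⟩
  have := Finset.card_union_le S S'
  refine ⟨S ∪ S', ?_, ?_, by omega⟩
  · rw [Finset.coe_union]
    exact Set.union_subset hST hS'T
  · rw [Finset.coe_union]
    exact top_le_iff.mp (hS'.symm.le.trans extend_extend_le)

/-- Over an algebraically closed field, a generating family of operators contains a small
generating subfamily. -/
theorem exists_finset_extend_eq_top {F V ι : Type*} [Field F] [IsAlgClosed F]
    [AddCommGroup V] [Module F V] [FiniteDimensional F V] [Nontrivial V] (f : ι → Module.End F V)
    (T : Set ι) (k : ℕ) (A : Subalgebra F (Module.End F V)) (hT : A.extend f T = ⊤)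
    (hk : Module.length A V ≤ k) :
    ∃ S : Finset ι, ↑S ⊆ T ∧ A.extend f S = ⊤ ∧ S.card + 1 ≤ 2 * k := by
  classical
  exact exists_finset_extend_eq_top_aux k
    (fun j _ B hB hBd hBj => exists_finset_extend_eq_top_of_isDegenerate j f T B hB hBd hBj) A hT hk

end Subalgebra

end UpperBound

section BaseChange

variable {F K m n : Type*} [Field F] [Field K] [Algebra F K]

/-- A subspace of matrices spanning all matrices over a larger field is everything. -/
theorem Matrix.eq_top_of_span_map_eq_top [Fintype m] [Fintype n] (W : Submodule F (Matrix m n F))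
    (hW : Submodule.span K ((fun M : Matrix m n F => M.map (algebraMap F K)) '' W) = ⊤) :
    W = ⊤ := by
  classical
  by_contra hne
  obtain ⟨φ, hφ, hWφ⟩ := W.exists_le_ker_of_lt_top (lt_top_iff_ne_top.mpr hne)
  let g : Matrix m n K →ₗ[K] K :=
    ∑ i, ∑ j, algebraMap F K (φ (Matrix.single i j 1)) • Matrix.entryLinearMap K K i j
  have hg : ∀ M : Matrix m n F, g (M.map (algebraMap F K)) = algebraMap F K (φ M) := by
    intro M
    have hM : φ M = ∑ i, ∑ j, M i j * φ (Matrix.single i j 1) := by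
      conv_lhs => rw [Matrix.matrix_eq_sum_single M]
      simp only [map_sum]
      refine Finset.sum_congr rfl fun i _ => Finset.sum_congr rfl fun j _ => ?_
      rw [← smul_eq_mul, ← map_smul, Matrix.smul_single, smul_eq_mul, mul_one]
    simp [g, hM, Algebra.smul_def, mul_comm]
  have hg0 : (⊤ : Submodule K (Matrix m n K)) ≤ LinearMap.ker g := by
    rw [← hW, Submodule.span_le]
    rintro _ ⟨M, hM, rfl⟩
    rw [SetLike.mem_coe, LinearMap.mem_ker, hg, LinearMap.mem_ker.mp (hWφ hM), map_zero]
  refine hφ (LinearMap.ext fun M => (algebraMap F K).injective ?_)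
  rw [← hg, LinearMap.mem_ker.mp (hg0 trivial), LinearMap.zero_apply, map_zero]

variable [Fintype n] [DecidableEq n]

theorem Matrix.adjoin_map_eq_top {S : Set (Matrix n n F)} (hS : Algebra.adjoin F S = ⊤) :
    Algebra.adjoin K ((fun M : Matrix n n F => M.map (algebraMap F K)) '' S) = ⊤ := by
  have key : ∀ M ∈ Algebra.adjoin F S, M.map (algebraMap F K) ∈
      Algebra.adjoin K ((fun M : Matrix n n F => M.map (algebraMap F K)) '' S) := by
    intro M hM
    induction hM using Algebra.adjoin_induction with
    | mem M hM => exact Algebra.subset_adjoin ⟨M, hM, rfl⟩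
    | algebraMap r =>
      have : (algebraMap F (Matrix n n F) r).map (algebraMap F K) =
          algebraMap K (Matrix n n K) (algebraMap F K r) := by
        simp [Matrix.algebraMap_eq_diagonal, Matrix.diagonal_map]
      rw [this]
      exact Subalgebra.algebraMap_mem _ _
    | add M N _ _ hM hN =>
      rw [Matrix.map_add _ (map_add _)]
      exact add_mem hM hN
    | mul M N _ _ hM hN =>
      rw [Matrix.map_mul]
      exact mul_mem hM hN
  rw [eq_top_iff]
  intro X _
  rw [Matrix.matrix_eq_sum_single X]
  refine sum_mem fun i _ => sum_mem fun j _ => ?_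
  have := key (Matrix.single i j 1) (hS ▸ Algebra.mem_top)
  rw [Matrix.map_single, map_one] at this
  simpa using Subalgebra.smul_mem _ this (X i j)

theorem Matrix.adjoin_eq_top_of_map {S : Set (Matrix n n F)}
    (hS : Algebra.adjoin K ((fun M : Matrix n n F => M.map (algebraMap F K)) '' S) = ⊤) :
    Algebra.adjoin F S = ⊤ := by
  rw [← Algebra.toSubmodule_eq_top]
  refine Matrix.eq_top_of_span_map_eq_top (K := K) _ ?_
  rw [eq_top_iff, ← Algebra.top_toSubmodule, ← hS, Algebra.adjoin_eq_span]
  refine Submodule.span_mono ?_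
  have hcl : Submonoid.closure ((fun M : Matrix n n F => M.map (algebraMap F K)) '' S) ≤
      (Algebra.adjoin F S).toSubmonoid.map (algebraMap F K).mapMatrix := by
    rw [Submonoid.closure_le]
    rintro _ ⟨M, hM, rfl⟩
    exact ⟨M, Algebra.subset_adjoin hM, rfl⟩
  rintro X hX
  exact hcl hX

end BaseChange

/-- A generating set of a matrix algebra contains a small finite generating set. -/
theorem Matrix.exists_finset_adjoin_eq_top {F : Type*} [Field F] {n : ℕ} (hn : 0 < n)
    (S : Set (Matrix (Fin n) (Fin n) F)) (hS : Algebra.adjoin F S = ⊤) :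
    ∃ T : Finset (Matrix (Fin n) (Fin n) F), ↑T ⊆ S ∧
      Algebra.adjoin F (T : Set (Matrix (Fin n) (Fin n) F)) = ⊤ ∧ T.card + 1 ≤ 2 * n := by
  let K := AlgebraicClosure F
  have : Nonempty (Fin n) := ⟨⟨0, hn⟩⟩
  let b : Matrix (Fin n) (Fin n) F → Matrix (Fin n) (Fin n) K := fun M => M.map (algebraMap F K)
  let e : Matrix (Fin n) (Fin n) K ≃ₐ[K] Module.End K (Fin n → K) := Matrix.toLinAlgEquiv'
  have himage : ∀ T : Set (Matrix (Fin n) (Fin n) F),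
      (⊥ : Subalgebra K (Module.End K (Fin n → K))).extend (e ∘ b) T =
        (Algebra.adjoin K (b '' T)).map (e : _ →ₐ[K] _) := by
    intro T
    rw [Subalgebra.extend, bot_sup_eq, Set.image_comp, AlgHom.map_adjoin]
    rfl
  have hlen : Module.length (⊥ : Subalgebra K (Module.End K (Fin n → K))) (Fin n → K) ≤ n := by
    refine (Module.length_le_of_pullback (R := K) (AddMonoidHom.id (Fin n → K))
      Function.surjective_id fun r => ⟨⟨algebraMap K _ r, Subalgebra.algebraMap_mem _ r⟩,
        fun _ => rfl⟩).trans ?_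
    rw [Module.length_of_free]
    simp
  obtain ⟨T, hTS, hT, hc⟩ := Subalgebra.exists_finset_extend_eq_top (e ∘ b) S n ⊥ (by
    rw [himage, Matrix.adjoin_map_eq_top hS, Algebra.map_top, AlgHom.range_eq_top]
    exact e.surjective) hlen
  refine ⟨T, hTS, Matrix.adjoin_eq_top_of_map (K := K) ?_, hc⟩
  rw [himage, eq_top_iff] at hT
  rw [eq_top_iff]
  intro X _
  obtain ⟨Y, hY, hYX⟩ := hT (show e X ∈ ⊤ from trivial)
  exact e.injective hYX ▸ hY

section Lower

namespace Matrix

variable (F : Type*) [Field F] (m : ℕ)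

/-- An irredundant generating family of the algebra of square matrices of size `m + 1`. -/
def irredundantGenerator : Option (Fin m ⊕ Fin m) → Matrix (Fin (m + 1)) (Fin (m + 1)) F
  | none => single 0 0 1
  | some (.inl i) => single i.succ i.castSucc 1 - single i.succ i.succ 1
  | some (.inr i) => single i.castSucc i.succ 1 - single i.castSucc i.castSucc 1

/-- The vectors in a subspace that is stable under all generators but one. -/
def irredundantWitness : Option (Fin m ⊕ Fin m) → Submodule F (Fin (m + 1) → F)
  | none => Submodule.span F {fun _ => 1}
  | some (.inl i) => ⨅ k ∈ {k | i.castSucc < k}, LinearMap.ker (LinearMap.proj k)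
  | some (.inr i) => ⨅ k ∈ {k | k ≤ i.castSucc}, LinearMap.ker (LinearMap.proj k)

variable {F m}

theorem adjoin_irredundantGenerator :
    Algebra.adjoin F (Set.range (irredundantGenerator F m)) = ⊤ := by
  set A := Algebra.adjoin F (Set.range (irredundantGenerator F m)) with hA
  have hmem : ∀ o, irredundantGenerator F m o ∈ A := fun o => Algebra.subset_adjoin ⟨o, rfl⟩
  have hdown : ∀ i : Fin m, single i.castSucc i.castSucc (1 : F) ∈ A →
      single i.succ i.castSucc (1 : F) ∈ A := by
    intro i hi
    have := A.mul_mem (hmem (some (.inl i))) hi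
    simpa [irredundantGenerator, sub_mul, (Fin.castSucc_lt_succ (i := i)).ne'] using this
  have hup : ∀ i : Fin m, single i.castSucc i.castSucc (1 : F) ∈ A →
      single i.castSucc i.succ (1 : F) ∈ A := by
    intro i hi
    have := A.add_mem (A.mul_mem hi (hmem (some (.inr i)))) hi
    simpa [irredundantGenerator, mul_sub] using this
  have hdiag : ∀ k : Fin (m + 1), single k k (1 : F) ∈ A := by
    intro k
    induction k using Fin.induction with
    | zero => exact hmem none
    | succ i hi =>
      have := A.mul_mem (hdown i hi) (hup i hi)
      simpa using this
  have hrow : ∀ k : Fin (m + 1), single k 0 (1 : F) ∈ A := by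
    intro k
    induction k using Fin.induction with
    | zero => exact hdiag 0
    | succ i hi =>
      have := A.mul_mem (hdown i (hdiag _)) hi
      simpa using this
  have hcol : ∀ k : Fin (m + 1), single 0 k (1 : F) ∈ A := by
    intro k
    induction k using Fin.induction with
    | zero => exact hdiag 0
    | succ i hi =>
      have := A.mul_mem hi (hup i (hdiag _))
      simpa using this
  rw [eq_top_iff]
  intro X _
  rw [matrix_eq_sum_single X]
  refine sum_mem fun i _ => sum_mem fun j _ => ?_
  have := A.smul_mem (A.mul_mem (hrow i) (hcol j)) (X i j)
  simpa using this

theorem irredundantGenerator_mulVec_mem {o o' : Option (Fin m ⊕ Fin m)} (h : o ≠ o')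
    {v : Fin (m + 1) → F} (hv : v ∈ irredundantWitness F m o') :
    irredundantGenerator F m o *ᵥ v ∈ irredundantWitness F m o' := by
  rcases o' with _ | i | i
  · rw [irredundantWitness, Submodule.mem_span_singleton] at hv ⊢
    obtain ⟨c, rfl⟩ := hv
    refine ⟨0, ?_⟩
    rcases o with _ | j | j
    · exact absurd rfl h
    · simp [irredundantGenerator, sub_mulVec, single_mulVec]
    · simp [irredundantGenerator, sub_mulVec, single_mulVec]
  · simp only [irredundantWitness, Submodule.mem_iInf, LinearMap.mem_ker, LinearMap.proj_apply,
      Set.mem_ofPred_eq] at hv ⊢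
    intro k hk
    rcases o with _ | j | j
    · have hk0 : k ≠ 0 := (Fin.zero_le _).trans_lt hk |>.ne'
      simp [irredundantGenerator, single_mulVec, hk0]
    · have hij : j ≠ i := fun e => h (by rw [e])
      rcases eq_or_ne k j.succ with rfl | hkj
      · have : i.castSucc < j.castSucc := by
          rw [Fin.lt_def] at hk ⊢
          have := Fin.val_ne_of_ne hij
          simp at hk ⊢
          omega
        simp [irredundantGenerator, sub_mulVec, single_mulVec, hv _ this, hv _ hk]
      · simp [irredundantGenerator, sub_mulVec, single_mulVec, hkj]
    · rcases eq_or_ne k j.castSucc with rfl | hkj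
      · have : i.castSucc < j.succ := hk.trans Fin.castSucc_lt_succ
        simp [irredundantGenerator, sub_mulVec, single_mulVec, hv _ this, hv _ hk]
      · simp [irredundantGenerator, sub_mulVec, single_mulVec, hkj]
  · simp only [irredundantWitness, Submodule.mem_iInf, LinearMap.mem_ker, LinearMap.proj_apply,
      Set.mem_ofPred_eq] at hv ⊢
    intro k hk
    rcases o with _ | j | j
    · have := hv 0 (Fin.zero_le _)
      simp [irredundantGenerator, single_mulVec, this]
    · rcases eq_or_ne k j.succ with rfl | hkj
      · have : j.castSucc ≤ i.castSucc := Fin.castSucc_lt_succ.le.trans hk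
        simp [irredundantGenerator, sub_mulVec, single_mulVec, hv _ this, hv _ hk]
      · simp [irredundantGenerator, sub_mulVec, single_mulVec, hkj]
    · have hij : j ≠ i := fun e => h (by rw [e])
      rcases eq_or_ne k j.castSucc with rfl | hkj
      · have : j.succ ≤ i.castSucc := by
          rw [Fin.le_def] at hk ⊢
          have := Fin.val_ne_of_ne hij
          simp at hk ⊢
          omega
        simp [irredundantGenerator, sub_mulVec, single_mulVec, hv _ this, hv _ hk]
      · simp [irredundantGenerator, sub_mulVec, single_mulVec, hkj]

theorem exists_irredundantGenerator_mulVec_notMem (hm : 0 < m) (o : Option (Fin m ⊕ Fin m)) :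
    ∃ v ∈ irredundantWitness F m o,
      irredundantGenerator F m o *ᵥ v ∉ irredundantWitness F m o := by
  rcases o with _ | i | i
  · refine ⟨fun _ => 1, Submodule.mem_span_singleton_self _, fun h => ?_⟩
    rw [irredundantWitness, Submodule.mem_span_singleton] at h
    obtain ⟨c, hc⟩ := h
    have h0 := congrFun hc 0
    have h1 := congrFun hc (Fin.succ ⟨0, hm⟩)
    simp [irredundantGenerator, single_mulVec] at h0 h1
    simp [h0] at h1
  · refine ⟨Pi.single i.castSucc 1, ?_, ?_⟩
    · simp only [irredundantWitness, Submodule.mem_iInf, LinearMap.mem_ker, LinearMap.proj_apply,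
        Set.mem_ofPred_eq]
      exact fun k hk => Pi.single_eq_of_ne hk.ne' _
    · simp only [irredundantWitness, Submodule.mem_iInf, LinearMap.mem_ker, LinearMap.proj_apply,
        Set.mem_ofPred_eq]
      intro h
      have := h i.succ Fin.castSucc_lt_succ
      simp [irredundantGenerator, (Fin.castSucc_lt_succ (i := i)).ne'] at this
  · refine ⟨Pi.single i.succ 1, ?_, ?_⟩
    · simp only [irredundantWitness, Submodule.mem_iInf, LinearMap.mem_ker, LinearMap.proj_apply,
        Set.mem_ofPred_eq]
      exact fun k hk => Pi.single_eq_of_ne (hk.trans_lt Fin.castSucc_lt_succ).ne _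
    · simp only [irredundantWitness, Submodule.mem_iInf, LinearMap.mem_ker, LinearMap.proj_apply,
        Set.mem_ofPred_eq]
      intro h
      have := h i.castSucc le_rfl
      simp [irredundantGenerator, (Fin.castSucc_lt_succ (i := i)).ne] at this

theorem irredundantGenerator_injective (hm : 0 < m) :
    Function.Injective (irredundantGenerator F m) := by
  intro o o' h
  by_contra hne
  obtain ⟨v, hv, hv'⟩ := exists_irredundantGenerator_mulVec_notMem (F := F) hm o'
  exact hv' (h ▸ irredundantGenerator_mulVec_mem hne hv)

theorem adjoin_ne_top_of_ssubset_range_irredundantGenerator (hm : 0 < m)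
    {T : Set (Matrix (Fin (m + 1)) (Fin (m + 1)) F)}
    (hT : T ⊂ Set.range (irredundantGenerator F m)) : Algebra.adjoin F T ≠ ⊤ := by
  intro htop
  obtain ⟨hsub, _, ⟨o, rfl⟩, ho⟩ := Set.ssubset_iff_exists.mp hT
  obtain ⟨v, hv, hv'⟩ := exists_irredundantGenerator_mulVec_notMem (F := F) hm o
  let e : Matrix (Fin (m + 1)) (Fin (m + 1)) F →ₐ[F] Module.End F (Fin (m + 1) → F) :=
    toLinAlgEquiv'.toAlgHom
  have hle : Algebra.adjoin F T ≤ (irredundantWitness F m o).stabilizer.comap e := by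
    refine Algebra.adjoin_le fun M hM => ?_
    obtain ⟨o', rfl⟩ := hsub hM
    intro w hw
    exact irredundantGenerator_mulVec_mem (o := o') (o' := o) (fun h => ho (h ▸ hM)) hw
  exact hv' (hle (htop ▸ Algebra.mem_top : irredundantGenerator F m o ∈ Algebra.adjoin F T) v hv)

end Matrix

end Lower

theorem stmt_5 (F : Type*) [Field F] (n : ℕ) (hn : 1 < n) :
    (∃ S : Set (Matrix (Fin n) (Fin n) F),
      Algebra.adjoin F S = ⊤ ∧ (∀ T ⊂ S, Algebra.adjoin F T ≠ ⊤) ∧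
      S.Finite ∧ S.ncard = 2 * n - 1) ∧
    (∀ S : Set (Matrix (Fin n) (Fin n) F),
      Algebra.adjoin F S = ⊤ → (∀ T ⊂ S, Algebra.adjoin F T ≠ ⊤) →
      S.Finite ∧ S.ncard ≤ 2 * n - 1) := by
  constructor
  · obtain ⟨m, rfl⟩ : ∃ m, n = m + 1 := ⟨n - 1, by omega⟩
    have hm : 0 < m := by omega
    refine ⟨Set.range (Matrix.irredundantGenerator F m), Matrix.adjoin_irredundantGenerator,
      fun T hT => Matrix.adjoin_ne_top_of_ssubset_range_irredundantGenerator hm hT,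
      Set.finite_range _, ?_⟩
    rw [← Set.image_univ, Set.ncard_image_of_injective _ (Matrix.irredundantGenerator_injective hm),
      Set.ncard_univ, Nat.card_eq_fintype_card]
    simp
    omega
  · intro S hS hirr
    obtain ⟨T, hTS, hT, hc⟩ := Matrix.exists_finset_adjoin_eq_top (by omega) S hS
    have hTS' : ↑T = S := by
      by_contra hne
      exact hirr _ (hTS.ssubset_of_ne hne) hT
    subst hTS'
    refine ⟨T.finite_toSet, ?_⟩
    rw [Set.ncard_coe_finset]
    omega
end

section
/- If |F| > 2, then any GL_2(F)-independent subset of Sub(F^2) has at most 3 elements, and a 3-element subset is GL_2(F)-independent if and only if it consists of three distinct 1-dimensional subspaces. -/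
open Matrix

/-- `S ⊆ Sub(F²)` is `GL₂(F)`-independent if for every `V ∈ S` there is a
`g ∈ GL₂(F)` stabilizing every member of `S \ {V}` but not `V`. -/
def glIndep {F : Type*} [Field F] {n : ℕ} (S : Set (Submodule F (Fin n → F))) : Prop :=
  ∀ V ∈ S, ∃ g : GL (Fin n) F,
    (∀ U ∈ S \ {V},
      U.map ((g : Matrix (Fin n) (Fin n) F).mulVecLin) = U) ∧
    V.map ((g : Matrix (Fin n) (Fin n) F).mulVecLin) ≠ V

/-- The determinant of the pair `u`, `v` of vectors of `F²`. -/
def pairDet {F : Type*} [Field F] (u v : Fin 2 → F) : F := u 0 * v 1 - u 1 * v 0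

theorem pairDet_self {F : Type*} [Field F] (u : Fin 2 → F) : pairDet u u = 0 := by
  simp [pairDet, mul_comm]

theorem pairDet_smul_eq_add {F : Type*} [Field F] (u v w : Fin 2 → F) :
    pairDet u v • w = pairDet w v • u + pairDet u w • v := by
  ext i
  fin_cases i <;> simp [pairDet] <;> ring

theorem pairDet_ne_zero_of_span_ne {F : Type*} [Field F] {u v : Fin 2 → F} (hu : u ≠ 0)
    (hv : v ≠ 0) (h : Submodule.span F {u} ≠ Submodule.span F {v}) : pairDet u v ≠ 0 := by
  have parallel : ∀ {u v : Fin 2 → F}, u ≠ 0 → pairDet u v = 0 →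
      Submodule.span F {v} ≤ Submodule.span F {u} := by
    intro u v hu h0
    rw [Submodule.span_singleton_le_iff_mem, Submodule.mem_span_singleton]
    obtain ⟨i, hi⟩ := Function.ne_iff.mp hu
    refine ⟨v i / u i, ?_⟩
    simp only [pairDet] at h0
    ext j
    fin_cases i <;> fin_cases j <;> simp at hi ⊢ <;> grind
  intro h0
  refine h (le_antisymm (parallel hv ?_) (parallel hu h0))
  simp only [pairDet] at h0 ⊢
  linear_combination -h0

theorem exists_span_singleton_of_finrank_eq_one {F E : Type*} [Field F] [AddCommGroup E]
    [Module F E] {V : Submodule F E} (hV : Module.finrank F V = 1) :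
    ∃ v, v ≠ 0 ∧ V = Submodule.span F {v} := by
  obtain ⟨v, hv, hspan⟩ := finrank_eq_one_iff'.mp hV
  refine ⟨v, by simpa using hv, le_antisymm (fun w hw => ?_) (by simp)⟩
  obtain ⟨c, hc⟩ := hspan ⟨w, hw⟩
  exact Submodule.mem_span_singleton.mpr ⟨c, congrArg Subtype.val hc⟩

theorem exists_mulVec_eq_smul_of_map_span_eq {F : Type*} [Field F] {n : ℕ}
    {M : Matrix (Fin n) (Fin n) F} {v : Fin n → F}
    (h : (Submodule.span F {v}).map M.mulVecLin = Submodule.span F {v}) :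
    ∃ c : F, M *ᵥ v = c • v := by
  have hmem : M.mulVecLin v ∈ Submodule.span F {v} :=
    h ▸ Submodule.mem_map_of_mem (Submodule.mem_span_singleton_self v)
  obtain ⟨c, hc⟩ := Submodule.mem_span_singleton.mp hmem
  exact ⟨c, hc.symm⟩

theorem mulVecLin_injective_of_gl {F : Type*} [Field F] {n : ℕ} (g : GL (Fin n) F) :
    Function.Injective (g : Matrix (Fin n) (Fin n) F).mulVecLin :=
  Matrix.mulVec_injective_of_isUnit g.isUnit

theorem map_top_of_gl {F : Type*} [Field F] {n : ℕ} (g : GL (Fin n) F) :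
    (⊤ : Submodule F (Fin n → F)).map (g : Matrix (Fin n) (Fin n) F).mulVecLin = ⊤ := by
  rw [Submodule.map_top, LinearMap.range_eq_top]
  exact LinearMap.injective_iff_surjective.mp (mulVecLin_injective_of_gl g)

theorem map_eq_of_gl_of_le {F : Type*} [Field F] {n : ℕ} (g : GL (Fin n) F)
    {V : Submodule F (Fin n → F)}
    (h : V.map (g : Matrix (Fin n) (Fin n) F).mulVecLin ≤ V) :
    V.map (g : Matrix (Fin n) (Fin n) F).mulVecLin = V :=
  Submodule.eq_of_le_of_finrank_eq h
    (Submodule.equivMapOfInjective _ (mulVecLin_injective_of_gl g) V).finrank_eq.symm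

theorem map_eq_of_gl_of_scalar {F : Type*} [Field F] {n : ℕ} (g : GL (Fin n) F) (c : F)
    (hg : ∀ w, (g : Matrix (Fin n) (Fin n) F) *ᵥ w = c • w) (V : Submodule F (Fin n → F)) :
    V.map (g : Matrix (Fin n) (Fin n) F).mulVecLin = V := by
  refine map_eq_of_gl_of_le g ?_
  rintro _ ⟨w, hw, rfl⟩
  rw [Matrix.mulVecLin_apply, hg]
  exact V.smul_mem c hw

theorem map_span_singleton_eq_of_gl {F : Type*} [Field F] {n : ℕ} (g : GL (Fin n) F)
    {v : Fin n → F} {c : F} (h : (g : Matrix (Fin n) (Fin n) F) *ᵥ v = c • v) :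
    (Submodule.span F {v}).map (g : Matrix (Fin n) (Fin n) F).mulVecLin =
      Submodule.span F {v} := by
  refine map_eq_of_gl_of_le g ?_
  rw [Submodule.map_span_le]
  rintro w rfl
  rw [Matrix.mulVecLin_apply, h]
  exact Submodule.smul_mem _ c (Submodule.mem_span_singleton_self _)

theorem mulVec_scalar_of_three_eigenvectors {F : Type*} [Field F]
    {M : Matrix (Fin 2) (Fin 2) F} {u v w : Fin 2 → F} {a b c : F}
    (huv : pairDet u v ≠ 0) (huw : pairDet u w ≠ 0) (hwv : pairDet w v ≠ 0)
    (hu : M *ᵥ u = a • u) (hv : M *ᵥ v = b • v) (hw : M *ᵥ w = c • w) (x : Fin 2 → F) :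
    M *ᵥ x = a • x := by
  have expand (y : Fin 2 → F) :
      pairDet u v • (M *ᵥ y) = (pairDet y v * a) • u + (pairDet u y * b) • v := by
    rw [← Matrix.mulVec_smul, pairDet_smul_eq_add, Matrix.mulVec_add, Matrix.mulVec_smul,
      Matrix.mulVec_smul, hu, hv, smul_smul, smul_smul]
  have hab : a = b := by
    have h := expand w
    rw [hw] at h
    have h0 := congrFun h 0
    have h1 := congrFun h 1
    simp only [Pi.add_apply, Pi.smul_apply, smul_eq_mul] at h0 h1
    have key : pairDet w v * pairDet u w * (a - b) = 0 := by
      simp only [pairDet] at h0 h1 ⊢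
      linear_combination (-w 1) * h0 + w 0 * h1
    simpa [huw, hwv, sub_eq_zero] using key
  subst hab
  refine smul_right_injective _ huv ?_
  change pairDet u v • (M *ᵥ x) = pairDet u v • (a • x)
  rw [expand, smul_comm, pairDet_smul_eq_add, smul_add, smul_smul, smul_smul, mul_comm a,
    mul_comm a]

theorem glIndep.finrank_eq_one {F : Type*} [Field F] {S : Set (Submodule F (Fin 2 → F))}
    (hS : glIndep S) {V : Submodule F (Fin 2 → F)} (hV : V ∈ S) : Module.finrank F V = 1 := by
  obtain ⟨g, -, hg⟩ := hS V hV
  have hle := V.finrank_le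
  rw [Module.finrank_fin_fun] at hle
  have h0 : Module.finrank F V ≠ 0 := fun h => hg (by
    rw [Submodule.finrank_eq_zero.mp h, Submodule.map_bot])
  have h2 : Module.finrank F V ≠ 2 := fun h => hg (by
    rw [Submodule.eq_top_of_finrank_eq (h.trans (Module.finrank_fin_fun F).symm),
      map_top_of_gl])
  omega

theorem glIndep.encard_le_three {F : Type*} [Field F] {S : Set (Submodule F (Fin 2 → F))}
    (hS : glIndep S) : S.encard ≤ 3 := by
  rcases S.eq_empty_or_nonempty with rfl | ⟨V, hV⟩
  · simp
  rw [← Set.encard_sdiff_singleton_add_one hV]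
  suffices h : (S \ {V}).encard ≤ 2 from
    (add_le_add_left h 1).trans (by norm_num)
  by_contra! h
  have h3 : (3 : ℕ∞) ≤ (S \ {V}).encard :=
    (by norm_num : (3 : ℕ∞) = 2 + 1) ▸ Order.add_one_le_of_lt h
  obtain ⟨T, hT, hcard⟩ := Set.exists_subset_encard_eq h3
  obtain ⟨U₁, U₂, U₃, h₁₂, h₁₃, h₂₃, rfl⟩ := Set.encard_eq_three.mp hcard
  obtain ⟨g, hfix, hmove⟩ := hS V hV
  have m₁ : U₁ ∈ S \ {V} := hT (by simp)
  have m₂ : U₂ ∈ S \ {V} := hT (by simp)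
  have m₃ : U₃ ∈ S \ {V} := hT (by simp)
  obtain ⟨u, hu, rfl⟩ := exists_span_singleton_of_finrank_eq_one (hS.finrank_eq_one m₁.1)
  obtain ⟨v, hv, rfl⟩ := exists_span_singleton_of_finrank_eq_one (hS.finrank_eq_one m₂.1)
  obtain ⟨w, hw, rfl⟩ := exists_span_singleton_of_finrank_eq_one (hS.finrank_eq_one m₃.1)
  obtain ⟨a, ha⟩ := exists_mulVec_eq_smul_of_map_span_eq (hfix _ m₁)
  obtain ⟨b, hb⟩ := exists_mulVec_eq_smul_of_map_span_eq (hfix _ m₂)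
  obtain ⟨c, hc⟩ := exists_mulVec_eq_smul_of_map_span_eq (hfix _ m₃)
  exact hmove (map_eq_of_gl_of_scalar g a
    (mulVec_scalar_of_three_eigenvectors (pairDet_ne_zero_of_span_ne hu hv h₁₂)
      (pairDet_ne_zero_of_span_ne hu hw h₁₃) (pairDet_ne_zero_of_span_ne hw hv h₂₃.symm)
      ha hb hc) V)

theorem exists_gl_mulVec_eq {F : Type*} [Field F] {u v : Fin 2 → F} (huv : pairDet u v ≠ 0)
    {a : F} (ha : a ≠ 0) :
    ∃ g : GL (Fin 2) F, ∀ w, pairDet u v • ((g : Matrix (Fin 2) (Fin 2) F) *ᵥ w) =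
      pairDet w v • u + (a * pairDet u w) • v := by
  let k := (a - 1) / pairDet u v
  have hk : k * pairDet u v = a - 1 := div_mul_cancel₀ _ huv
  let M : Matrix (Fin 2) (Fin 2) F :=
    !![1 - k * v 0 * u 1, k * v 0 * u 0; -(k * v 1 * u 1), 1 + k * v 1 * u 0]
  have hdet : M.det = a := by
    simp only [M, Matrix.det_fin_two_of]
    simp only [pairDet] at hk
    linear_combination hk
  refine ⟨Matrix.GeneralLinearGroup.mkOfDetNeZero M (hdet ▸ ha), fun w => ?_⟩
  change pairDet u v • (M *ᵥ w) = _
  simp only [pairDet] at hk ⊢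
  ext i
  fin_cases i
  · simp [M, dotProduct, Fin.sum_univ_two]
    linear_combination (u 0 * w 1 - u 1 * w 0) * v 0 * hk
  · simp [M, dotProduct, Fin.sum_univ_two]
    linear_combination (u 0 * w 1 - u 1 * w 0) * v 1 * hk

/-- Over a field with more than two elements, two of three distinct lines of the plane can be
stabilized while the third one is moved. -/
theorem exists_gl_fix_two_move_third {F : Type*} [Field F]
    (hF : (2 : Cardinal) < Cardinal.mk F) {U₁ U₂ V : Submodule F (Fin 2 → F)}
    (h₁ : Module.finrank F U₁ = 1) (h₂ : Module.finrank F U₂ = 1) (h : Module.finrank F V = 1)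
    (h₁₂ : U₁ ≠ U₂) (h₁V : U₁ ≠ V) (h₂V : U₂ ≠ V) :
    ∃ g : GL (Fin 2) F,
      U₁.map ((g : Matrix (Fin 2) (Fin 2) F).mulVecLin) = U₁ ∧
      U₂.map ((g : Matrix (Fin 2) (Fin 2) F).mulVecLin) = U₂ ∧
      V.map ((g : Matrix (Fin 2) (Fin 2) F).mulVecLin) ≠ V := by
  obtain ⟨a, ha0, ha1⟩ : ∃ a : F, a ≠ 0 ∧ a ≠ 1 := by
    by_contra! hall
    refine absurd hF (not_lt.mpr ?_)
    rw [← Cardinal.mk_univ]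
    have : (Set.univ : Set F) ⊆ {0, 1} := fun x _ => by
      by_cases hx : x = 0
      · simp [hx]
      · simp [hall x hx]
    refine (Cardinal.mk_le_mk_of_subset this).trans ?_
    rw [Cardinal.mk_insert (by simp), Cardinal.mk_singleton]
    norm_num
  obtain ⟨u, hu, rfl⟩ := exists_span_singleton_of_finrank_eq_one h₁
  obtain ⟨v, hv, rfl⟩ := exists_span_singleton_of_finrank_eq_one h₂
  obtain ⟨w, hw, rfl⟩ := exists_span_singleton_of_finrank_eq_one h
  have huv := pairDet_ne_zero_of_span_ne hu hv h₁₂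
  have huw := pairDet_ne_zero_of_span_ne hu hw h₁V
  have hwv := pairDet_ne_zero_of_span_ne hw hv h₂V.symm
  obtain ⟨g, hg⟩ := exists_gl_mulVec_eq huv ha0
  have gu : (g : Matrix (Fin 2) (Fin 2) F) *ᵥ u = (1 : F) • u := by
    refine smul_right_injective _ huv ?_
    simpa [pairDet_self] using hg u
  have gv : (g : Matrix (Fin 2) (Fin 2) F) *ᵥ v = a • v := by
    refine smul_right_injective _ huv ?_
    simpa [pairDet_self, smul_smul, mul_comm] using hg v
  refine ⟨g, map_span_singleton_eq_of_gl g gu, map_span_singleton_eq_of_gl g gv,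
    fun hfix => ha1 ?_⟩
  obtain ⟨c, hc⟩ := exists_mulVec_eq_smul_of_map_span_eq hfix
  have hscalar := mulVec_scalar_of_three_eigenvectors huv huw hwv gu gv hc v
  rw [gv] at hscalar
  exact smul_left_injective F hv hscalar

theorem stmt_14 (F : Type*) [Field F] (hF : (2 : Cardinal) < Cardinal.mk F) :
    (∀ S : Set (Submodule F (Fin 2 → F)), glIndep S → S.Finite ∧ S.ncard ≤ 3) ∧
    (∀ S : Set (Submodule F (Fin 2 → F)), S.Finite → S.ncard = 3 →
      (glIndep S ↔ ∀ V ∈ S, Module.finrank F V = 1)) := by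
  refine ⟨fun S hS => Set.encard_le_coe_iff_finite_ncard_le.mp hS.encard_le_three,
    fun S _ hcard => ⟨fun hS V hV => hS.finrank_eq_one hV, fun hdim V hV => ?_⟩⟩
  have hcard' : (S \ {V}).ncard = 2 := by
    rw [Set.ncard_sdiff_singleton_of_mem hV, hcard]
  obtain ⟨U₁, U₂, h₁₂, hS⟩ := Set.ncard_eq_two.mp hcard'
  have m₁ : U₁ ∈ S \ {V} := hS ▸ Set.mem_insert _ _
  have m₂ : U₂ ∈ S \ {V} := hS ▸ Set.mem_insert_of_mem _ rfl
  obtain ⟨g, hg₁, hg₂, hgV⟩ := exists_gl_fix_two_move_third hF (hdim _ m₁.1) (hdim _ m₂.1)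
    (hdim V hV) h₁₂ m₁.2 m₂.2
  refine ⟨g, ?_, hgV⟩
  rw [hS]
  rintro U (rfl | rfl)
  exacts [hg₁, hg₂]
end
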